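/- Let k ≥ 3, m ≥ 1, n_1, …, n_m ≥ 1 and r_i = n_i(k−1), and let λ ∈ ℂ satisfy λ ≠ 0 and λ^k − a_{i−1} ≠ 0 for all 0 ≤ i ≤ max_j n_j; assume the quotient algebra A is finite-dimensional over ℂ. Then the determinant of the ℂ-linear endomorphism of A given by multiplication by λ − ∑_{i=1}^{m} ∏_{v=1}^{k−1} x_{i,v} equals ∏_{(s_1,…,s_m), 0 ≤ s_i ≤ n_i} (λ − ∑_{i=1}^{m} a_{s_i−1}/λ^{k−1})^{∏_{i=1}^{m} μ_{n_i,k}(s_i)}. -/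

import Mathlib

open Finset MvPolynomial

/-- Vertex `v` belongs to the edge `e_t = {(t-1)(k-1), …, t(k-1)}` of a
hyperpath branch. -/
def inEdge (k t v : ℕ) : Prop := (t - 1) * (k - 1) ≤ v ∧ v ≤ t * (k - 1)

instance (k t v : ℕ) : Decidable (inEdge k t v) :=
  inferInstanceAs (Decidable (_ ∧ _))

/-- `aseq k λ i = a_{i-1}`, where `a_{-1} = 0`, `a_0 = 1` and
`a_i = λ^k/(λ^k - a_{i-1})` for `i ≥ 1`. -/
noncomputable def aseq (k : ℕ) (lam : ℂ) : ℕ → ℂ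
  | 0 => 0
  | 1 => 1
  | (i + 2) => lam ^ k / (lam ^ k - aseq k lam (i + 1))

/-- `μ_{n,k}(s)`: the multiplicity `k^{s(k-2)}·((k-1)^{k-1} - k^{k-2})·(k-1)^{(n-s-1)(k-1)}`
for `0 ≤ s ≤ n-1`, and `k^{n(k-2)}` for `s = n`. -/
def muPath (n k s : ℕ) : ℕ :=
  if s = n then k ^ (n * (k - 2))
  else k ^ (s * (k - 2)) * ((k - 1) ^ (k - 1) - k ^ (k - 2)) * (k - 1) ^ ((n - s - 1) * (k - 1))

/-- The variables of the starlike hypergraph `S^k_{n_1,…,n_m}` other than the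
centre `w`: `⟨i, u⟩` stands for the vertex `(i, u+1)`. -/
abbrev StarIdx (k m : ℕ) (n : Fin m → ℕ) : Type := (i : Fin m) × Fin (n i * (k - 1))

/-- The polynomial `f_{i,v} = λ·x_{i,v}^{k-1} - ∑_{t : (i,v) ∈ e_{i,t}}
∏_{(i,u) ∈ e_{i,t}, u ∉ {v,0}} x_{i,u}` for the starlike hypergraph. -/
noncomputable def fstar (k : ℕ) {m : ℕ} (n : Fin m → ℕ) (lam : ℂ)
    (p : StarIdx k m n) : MvPolynomial (StarIdx k m n) ℂ :=
  C lam * (X p) ^ (k - 1) -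
    ∑ t ∈ (Finset.Icc 1 (n p.1)).filter (fun t => inEdge k t (p.2.val + 1)),
      ∏ q ∈ (Finset.univ.filter
          (fun q : StarIdx k m n => q.1 = p.1 ∧ inEdge k t (q.2.val + 1))).erase p,
        X q

/-- The ideal generated by all the `f_{i,v}`; the quotient is the algebra `A`. -/
noncomputable def starIdeal (k : ℕ) {m : ℕ} (n : Fin m → ℕ) (lam : ℂ) :
    Ideal (MvPolynomial (StarIdx k m n) ℂ) :=
  Ideal.span (Set.range (fstar k n lam))

set_option linter.unusedSectionVars false

section Sandpile

variable {ι : Type} [Fintype ι] [DecidableEq ι]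

/-- One chip on every site other than `j`. -/
noncomputable def onesExcept (j : ι) : ι →₀ ℕ := ∑ i ∈ univ.erase j, Finsupp.single i 1

/-- One chip on every site. -/
noncomputable def onesConfig (ι : Type) [Fintype ι] : ι →₀ ℕ := ∑ i : ι, Finsupp.single i 1

lemma single_add_onesExcept (j : ι) :
    Finsupp.single j 1 + onesExcept j = onesConfig ι := by
  simp only [onesExcept, onesConfig]
  exact Finset.add_sum_erase univ (fun i => Finsupp.single i 1) (mem_univ j)

lemma degree_onesExcept (j : ι) : (onesExcept j).degree = Fintype.card ι - 1 := by
  simp [onesExcept, map_sum, Finset.card_erase_of_mem]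

lemma degree_onesConfig : (onesConfig ι).degree = Fintype.card ι := by
  simp [onesConfig, map_sum]

lemma onesConfig_apply (j : ι) : onesConfig ι j = 1 := by
  simp [onesConfig, Finsupp.finsetSum_apply, Finsupp.single_apply]

lemma onesExcept_apply (j i : ι) : onesExcept j i = if i = j then 0 else 1 := by
  have h := DFunLike.congr_fun (single_add_onesExcept j) i
  rw [Finsupp.add_apply, onesConfig_apply, Finsupp.single_apply] at h
  split_ifs at h ⊢ <;> first | omega | (subst_vars; simp_all)

lemma degree_topple_lt (j : ι) (β : ι →₀ ℕ) :
    (β + onesExcept j).degree < (β + Finsupp.single j (Fintype.card ι)).degree := by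
  have := Fintype.card_pos_iff.2 ⟨j⟩
  simp only [map_add, degree_onesExcept, Finsupp.degree_single]
  omega

lemma exists_add_single {j : ι} {N : ℕ} {α : ι →₀ ℕ} (h : N ≤ α j) :
    ∃ β : ι →₀ ℕ, α = β + Finsupp.single j N :=
  ⟨α - Finsupp.single j N, (tsub_add_cancel_of_le (by simpa using h)).symm⟩

open Classical in
/-- Stabilisation of a chip configuration on the complete graph on `ι` and a sink, where only
the sites of `J` may topple, paired with the number of topplings of each site. -/
noncomputable def stab (J : Finset ι) (α : ι →₀ ℕ) : (ι →₀ ℕ) × (ι →₀ ℕ) :=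
  if h : ∃ j ∈ J, Fintype.card ι ≤ α j then
    stab J (α - Finsupp.single h.choose (Fintype.card ι) + onesExcept h.choose) +
      (0, Finsupp.single h.choose 1)
  else (α, 0)
termination_by α.degree
decreasing_by
  have h2 := h.choose_spec.2
  refine (degree_topple_lt _ _).trans_eq ?_
  rw [tsub_add_cancel_of_le (by simpa using h2)]

variable {J : Finset ι}

lemma stab_of_stable {α : ι →₀ ℕ} (h : ∀ j ∈ J, α j < Fintype.card ι) :
    stab J α = (α, 0) := by
  rw [stab, dif_neg]
  rintro ⟨j, hj, hle⟩
  exact absurd (h j hj) (by omega)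

/-- Toppling is abelian: any legal toppling may be performed first. -/
lemma stab_topple (j : ι) (hj : j ∈ J) (β : ι →₀ ℕ) :
    stab J (β + Finsupp.single j (Fintype.card ι)) =
      stab J (β + onesExcept j) + (0, Finsupp.single j 1) := by
  induction hd : (β + Finsupp.single j (Fintype.card ι)).degree using Nat.strong_induction_on
    generalizing β j with
  | _ d ih =>
    have h : ∃ i ∈ J, Fintype.card ι ≤ (β + Finsupp.single j (Fintype.card ι)) i :=
      ⟨j, hj, by simp⟩
    rw [stab, dif_pos h]
    obtain ⟨hi, hle⟩ := h.choose_spec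
    generalize h.choose = i at hi hle
    by_cases hij : i = j
    · subst hij
      rw [add_tsub_cancel_right]
    · have hle' : Fintype.card ι ≤ β i := by
        simpa [Finsupp.single_apply, Ne.symm hij, eq_comm] using hle
      obtain ⟨γ, rfl⟩ := exists_add_single hle'
      have e1 : γ + Finsupp.single i (Fintype.card ι) + Finsupp.single j (Fintype.card ι)
          - Finsupp.single i (Fintype.card ι) + onesExcept i =
          (γ + onesExcept i) + Finsupp.single j (Fintype.card ι) := by
        rw [add_right_comm γ, add_tsub_cancel_right, add_right_comm]
      have e2 : γ + Finsupp.single i (Fintype.card ι) + onesExcept j =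
          (γ + onesExcept j) + Finsupp.single i (Fintype.card ι) := add_right_comm _ _ _
      have d1 : (γ + onesExcept i + Finsupp.single j (Fintype.card ι)).degree < d := by
        have := degree_topple_lt i (γ + Finsupp.single j (Fintype.card ι))
        rwa [add_right_comm, add_right_comm γ _ (Finsupp.single i _), hd] at this
      have d2 : (γ + onesExcept j + Finsupp.single i (Fintype.card ι)).degree < d := by
        have := degree_topple_lt j (γ + Finsupp.single i (Fintype.card ι))
        rwa [add_right_comm, hd] at this
      rw [e1, e2, ih _ d1 j hj (γ + onesExcept i) rfl, ih _ d2 i hi (γ + onesExcept j) rfl,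
        add_right_comm γ, add_right_comm (stab J (γ + onesExcept j + onesExcept i))]

lemma topple_induction {P : (ι →₀ ℕ) → Prop}
    (stable : ∀ α, (∀ j ∈ J, α j < Fintype.card ι) → P α)
    (topple : ∀ j ∈ J, ∀ β, P (β + onesExcept j) → P (β + Finsupp.single j (Fintype.card ι)))
    (α : ι →₀ ℕ) : P α := by
  induction hd : α.degree using Nat.strong_induction_on generalizing α with
  | _ d ih =>
    by_cases h : ∀ j ∈ J, α j < Fintype.card ι
    · exact stable α h
    · push Not at h
      obtain ⟨j, hj, hle⟩ := h
      obtain ⟨β, rfl⟩ := exists_add_single hle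
      exact topple j hj β (ih _ (hd ▸ degree_topple_lt _ _) _ rfl)

lemma stab_fst_lt (α : ι →₀ ℕ) : ∀ j ∈ J, (stab J α).1 j < Fintype.card ι := by
  induction α using topple_induction (J := J) with
  | stable α h => rwa [stab_of_stable h]
  | topple j hj β ih => simpa [stab_topple j hj] using ih

lemma stab_add (α β : ι →₀ ℕ) :
    stab J (α + β) = stab J ((stab J α).1 + β) + (0, (stab J α).2) := by
  induction α using topple_induction (J := J) with
  | stable α h => simp [stab_of_stable h, ← Prod.zero_eq_mk]
  | topple j hj γ ih =>
    rw [add_right_comm, stab_topple j hj, stab_topple j hj, add_right_comm, ih]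
    simp [add_assoc]

lemma degree_stab_le (α : ι →₀ ℕ) : (stab J α).1.degree ≤ α.degree := by
  induction α using topple_induction (J := J) with
  | stable α h => rw [stab_of_stable h]
  | topple j hj β ih =>
    rw [stab_topple j hj]
    simpa using ih.trans (degree_topple_lt j β).le

lemma stab_add_single_of_notMem {v : ι} (hv : v ∉ J) (N : ℕ) (α : ι →₀ ℕ) :
    stab J (α + Finsupp.single v N) = stab J α + (Finsupp.single v N, 0) := by
  rw [stab_add, stab_of_stable (α := (stab J α).1 + _)]
  · ext <;> simp
  · intro j hj
    have : v ≠ j := fun h => hv (h ▸ hj)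
    simpa [Finsupp.single_apply, this] using stab_fst_lt α j hj

lemma stab_add_smul (γ β : ι →₀ ℕ) :
    stab univ (β + (Fintype.card ι + 1) • γ) =
      stab univ (β + γ.degree • onesConfig ι) + (0, γ) := by
  induction γ using Finsupp.induction_linear generalizing β with
  | zero => simp [← Prod.zero_eq_mk]
  | add f g hf hg =>
    rw [smul_add, ← add_assoc, hg, add_right_comm, hf, map_add, add_smul,
      add_right_comm β, add_assoc (stab univ _), ← add_assoc β]
    simp
  | single j N =>
    induction N generalizing β with
    | zero => simp [← Prod.zero_eq_mk]
    | succ N ih =>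
      have e : β + (Fintype.card ι + 1) • Finsupp.single j (N + 1) =
          (β + Finsupp.single j 1 + (Fintype.card ι + 1) • Finsupp.single j N)
            + Finsupp.single j (Fintype.card ι) := by
        rw [Finsupp.single_add, smul_add,
          show (Fintype.card ι + 1) • Finsupp.single j 1 =
            Finsupp.single j 1 + Finsupp.single j (Fintype.card ι) by
            rw [add_comm (Finsupp.single j 1), ← Finsupp.single_add]; simp]
        abel
      rw [e, stab_topple j (mem_univ j), add_right_comm, add_assoc β, single_add_onesExcept, ih,
        Finsupp.degree_single, Finsupp.degree_single, add_smul, one_smul,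
        add_assoc (stab univ _), add_assoc β, add_comm (onesConfig ι)]
      simp [← Finsupp.single_add]

lemma stab_add_card_succ (β : ι →₀ ℕ) :
    stab univ (β + (Fintype.card ι + 1) • onesConfig ι) =
      stab univ (β + Fintype.card ι • onesConfig ι) + (0, onesConfig ι) := by
  rw [stab_add_smul, degree_onesConfig]

/-- A configuration reproduced by adding one chip to every site and stabilising. -/
def IsRecurrent (α : ι →₀ ℕ) : Prop := (stab univ (α + onesConfig ι)).1 = α

lemma IsRecurrent.lt {α : ι →₀ ℕ} (h : IsRecurrent α) (j : ι) : α j < Fintype.card ι := by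
  rw [← h]
  exact stab_fst_lt _ j (mem_univ j)

lemma IsRecurrent.stab_add_nsmul {α : ι →₀ ℕ} (h : IsRecurrent α) (N : ℕ) :
    stab univ (α + N • onesConfig ι) = (α, N • (stab univ (α + onesConfig ι)).2) := by
  induction N with
  | zero => simp [stab_of_stable fun j _ => h.lt j]
  | succ N ih =>
    rw [add_smul, one_smul, ← add_assoc, stab_add, ih]
    ext1
    · rw [Prod.fst_add, add_zero]
      exact h
    · simp [add_smul, add_comm]

lemma IsRecurrent.odometer {α : ι →₀ ℕ} (h : IsRecurrent α) :
    stab univ (α + onesConfig ι) = (α, onesConfig ι) := by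
  have h1 := stab_add_card_succ α
  rw [h.stab_add_nsmul, h.stab_add_nsmul] at h1
  have h2 := congrArg Prod.snd h1
  rw [add_smul, one_smul] at h2
  ext1
  · exact h
  · exact add_left_cancel h2

lemma isRecurrent_stab (β : ι →₀ ℕ) :
    IsRecurrent (stab univ (β + Fintype.card ι • onesConfig ι)).1 := by
  unfold IsRecurrent
  have h := stab_add_card_succ β
  rw [add_smul, one_smul, ← add_assoc, stab_add] at h
  simpa using congrArg Prod.fst h

lemma stab_fst_congr (α : ι →₀ ℕ) :
    ∃ t : ZMod (Fintype.card ι + 1), ∀ j,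
      (((stab univ α).1 j : ℕ) : ZMod (Fintype.card ι + 1)) + t = (α j : ℕ) := by
  induction α using topple_induction (J := (univ : Finset ι)) with
  | stable α h => exact ⟨0, by simp [stab_of_stable h]⟩
  | topple j hj β ih =>
    obtain ⟨t, ht⟩ := ih
    refine ⟨t - 1, fun i => ?_⟩
    have h := ht i
    have hL : ((Fintype.card ι : ℕ) : ZMod (Fintype.card ι + 1)) = -1 := by
      have := ZMod.natCast_self (Fintype.card ι + 1)
      push_cast at this
      linear_combination this
    rw [stab_topple j hj, Prod.fst_add, add_zero, ← add_sub_assoc, h]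
    by_cases hi : i = j
    · subst hi
      simp [onesExcept_apply, hL, sub_eq_add_neg]
    · simp [onesExcept_apply, hi]

lemma IsRecurrent.stab_eq {α δ : ι →₀ ℕ} (h : IsRecurrent α) (N : ℕ) :
    (stab univ (α + N • onesConfig ι + (Fintype.card ι + 1) • δ)).1 = α := by
  rw [stab_add_smul, add_assoc, ← add_smul, h.stab_add_nsmul]
  simp

open Classical in
/-- Recurrent configurations, seen as bounded functions. -/
lemma card_recurrent [Nonempty ι] :
    (univ.filter fun s : ι → Fin (Fintype.card ι) =>
      IsRecurrent (Finsupp.equivFunOnFinite.symm fun j => (s j : ℕ))).card =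
      (Fintype.card ι + 1) ^ (Fintype.card ι - 1) := by
  set L := Fintype.card ι with hL
  have hLpos : 0 < L := Fintype.card_pos
  let T := {s : ι → Fin L // IsRecurrent (Finsupp.equivFunOnFinite.symm fun j => (s j : ℕ))}
  let Φ : T × ZMod (L + 1) → (ι → ZMod (L + 1)) := fun p j => ((p.1.1 j : ℕ) : ZMod (L + 1)) + p.2
  have hΦ : Function.Bijective Φ := by
    constructor
    · rintro ⟨⟨a, ha⟩, t⟩ ⟨⟨b, hb⟩, s⟩ hab
      have key : ∀ j, ((a j : ℕ) + t.val) % (L + 1) = ((b j : ℕ) + s.val) % (L + 1) := by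
        intro j
        have := congrFun hab j
        simp only [Φ] at this
        rw [← Nat.ModEq, ← ZMod.natCast_eq_natCast_iff]
        push_cast
        simpa using this
      have e : (Finsupp.equivFunOnFinite.symm fun j => (a j : ℕ)) + t.val • onesConfig ι +
          (L + 1) • (Finsupp.equivFunOnFinite.symm fun j => ((b j : ℕ) + s.val) / (L + 1)) =
          (Finsupp.equivFunOnFinite.symm fun j => (b j : ℕ)) + s.val • onesConfig ι +
          (L + 1) • (Finsupp.equivFunOnFinite.symm fun j => ((a j : ℕ) + t.val) / (L + 1)) := by
        ext j
        simp only [Finsupp.add_apply, Finsupp.smul_apply, onesConfig_apply, smul_eq_mul, mul_one,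
          Finsupp.equivFunOnFinite_symm_apply_apply]
        have h1 := Nat.div_add_mod ((a j : ℕ) + t.val) (L + 1)
        have h2 := Nat.div_add_mod ((b j : ℕ) + s.val) (L + 1)
        have := key j
        omega
      have h1 := congrArg (fun x => (stab univ x).1) e
      simp only [hL] at h1
      rw [ha.stab_eq, hb.stab_eq] at h1
      have hab' : a = b := by
        funext j
        exact Fin.ext (by simpa using DFunLike.congr_fun h1 j)
      subst hab'
      obtain ⟨j⟩ := ‹Nonempty ι›
      have := congrFun hab j
      simp only [Φ, add_right_inj] at this
      rw [this]
    · intro ξ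
      let α : ι →₀ ℕ := Finsupp.equivFunOnFinite.symm fun j => (ξ j).val
      have hr := isRecurrent_stab α
      obtain ⟨t, ht⟩ := stab_fst_congr (α + L • onesConfig ι)
      set β := (stab univ (α + L • onesConfig ι)).1
      refine ⟨⟨⟨fun j => ⟨β j, hr.lt j⟩, ?_⟩, t - L⟩, ?_⟩
      · convert hr
        ext j
        simp [β, hL]
      · funext j
        have := ht j
        simp only [Φ]
        rw [← add_sub_assoc, this]
        simp [α, onesConfig_apply]
  have hc := Fintype.card_of_bijective hΦ
  rw [Fintype.card_prod, ZMod.card, Fintype.card_fun, ZMod.card, ← hL] at hc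
  have hT : Fintype.card T = (univ.filter fun s : ι → Fin L =>
      IsRecurrent (Finsupp.equivFunOnFinite.symm fun j => (s j : ℕ))).card := by
    rw [Fintype.card_subtype]
  rw [← hT]
  apply Nat.eq_of_mul_eq_mul_right (Nat.succ_pos L)
  rw [Nat.succ_eq_add_one, hc, ← pow_succ, Nat.sub_add_cancel hLpos]

end Sandpile

section ScalarFiltered

/-- The endomorphism `φ` of the `K`-module `M` preserves a finite filtration of `M` whose
successive quotients are isomorphic to `K`, with `φ` acting on them as `d * e` where `d` runs
through the multiset of complex numbers. -/
inductive ScalarFiltered {K : Type} [CommRing K] [Algebra ℂ K] (e : K) :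
    ∀ (M : Type) [AddCommGroup M] [Module K M], Module.End K M → Multiset ℂ → Prop
  | zero (M : Type) [AddCommGroup M] [Module K M] [Subsingleton M] (φ : Module.End K M) :
      ScalarFiltered e M φ 0
  | scalar {M : Type} [AddCommGroup M] [Module K M] {φ : Module.End K M} (d : ℂ) (f : M ≃ₗ[K] K)
      (hφ : ∀ x, φ x = (algebraMap ℂ K d * e) • x) : ScalarFiltered e M φ {d}
  | extension {M₁ M₂ M₃ : Type} [AddCommGroup M₁] [Module K M₁] [AddCommGroup M₂] [Module K M₂]
      [AddCommGroup M₃] [Module K M₃] {φ₁ : Module.End K M₁} {φ₂ : Module.End K M₂}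
      {φ₃ : Module.End K M₃} {S₁ S₃ : Multiset ℂ} (i : M₁ →ₗ[K] M₂) (p : M₂ →ₗ[K] M₃)
      (hi : Function.Injective i) (hp : Function.Surjective p) (hip : Function.Exact i p)
      (hφi : ∀ x, i (φ₁ x) = φ₂ (i x)) (hφp : ∀ x, p (φ₂ x) = φ₃ (p x))
      (h₁ : ScalarFiltered e M₁ φ₁ S₁) (h₃ : ScalarFiltered e M₃ φ₃ S₃) :
      ScalarFiltered e M₂ φ₂ (S₁ + S₃)

namespace ScalarFiltered

variable {K : Type} [CommRing K] [Algebra ℂ K] {e : K}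

lemma of_equiv {M N : Type} [AddCommGroup M] [Module K M] [AddCommGroup N] [Module K N]
    {φ : Module.End K M} {ψ : Module.End K N} {S : Multiset ℂ} (f : N ≃ₗ[K] M)
    (hf : ∀ x, f (ψ x) = φ (f x)) (h : ScalarFiltered e M φ S) : ScalarFiltered e N ψ S := by
  have := extension (φ₂ := ψ) (0 : PUnit →ₗ[K] N) f.toLinearMap
    (Function.injective_of_subsingleton _) f.surjective
    (fun y => by simp [eq_comm (a := (0 : N))]) (φ₁ := 0) (by simp) hf (zero _ _) h
  rwa [zero_add] at this

/-- An endomorphism that is triangular with respect to some ranking of the coordinates. -/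
lemma of_triangular {σ : Type} [Fintype σ] [DecidableEq σ] (φ : Module.End K (σ → K))
    (r : σ → ℕ) (d : σ → ℂ)
    (hdiag : ∀ s, φ (Pi.single s 1) s = algebraMap ℂ K (d s) * e)
    (hoff : ∀ s t, t ≠ s → r s ≤ r t → φ (Pi.single s 1) t = 0) :
    ScalarFiltered e (σ → K) φ (∑ s, {d s}) := by
  induction hN : Fintype.card σ generalizing σ with
  | zero =>
    have : IsEmpty σ := Fintype.card_eq_zero_iff.1 hN
    rw [Finset.univ_eq_empty, Finset.sum_empty]
    exact zero _ _
  | succ N ih =>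
    have : Nonempty σ := Fintype.card_pos_iff.1 (by omega)
    obtain ⟨s, hs⟩ := Finite.exists_max r
    let i : ({t // t ≠ s} → K) →ₗ[K] (σ → K) :=
      LinearMap.pi fun t => if h : t ≠ s then LinearMap.proj ⟨t, h⟩ else 0
    let q : (σ → K) →ₗ[K] ({t // t ≠ s} → K) := LinearMap.funLeft K K Subtype.val
    have his : ∀ x, i x s = 0 := fun x => by simp [i]
    have hit : ∀ x t (h : t ≠ s), i x t = x ⟨t, h⟩ := fun x t h => by simp [i, h]
    have hqi : ∀ y : σ → K, y s = 0 → i (q y) = y := by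
      intro y hy
      funext t
      by_cases h : t = s
      · subst h; rw [his, hy]
      · rw [hit _ _ h]; rfl
    have hlast : ∀ y : σ → K, φ y s = algebraMap ℂ K (d s) * e * y s := by
      intro y
      conv_lhs => rw [← Finset.univ_sum_single y]
      rw [map_sum, Finset.sum_apply, Finset.sum_eq_single s]
      · rw [show Pi.single s (y s) = y s • (Pi.single s (1 : K) : σ → K) by
          rw [← Pi.single_smul]; simp, map_smul, Pi.smul_apply, hdiag, smul_eq_mul, mul_comm]
      · intro t _ ht
        rw [show Pi.single t (y t) = y t • (Pi.single t (1 : K) : σ → K) by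
          rw [← Pi.single_smul]; simp, map_smul, Pi.smul_apply, hoff t s ht.symm (hs t), smul_zero]
      · simp
    have hisingle : ∀ t : {t // t ≠ s}, i (Pi.single t 1) = Pi.single t.1 1 := by
      intro t
      funext u
      by_cases h : u = s
      · subst h
        rw [his, Pi.single_eq_of_ne t.2.symm]
      · rw [hit _ _ h]
        simp [Pi.single_apply, Subtype.ext_iff]
    rw [Fintype.sum_eq_add_sum_subtype_ne _ s, add_comm]
    refine extension (φ₁ := q ∘ₗ φ ∘ₗ i) i (LinearMap.proj s) ?_ ?_ ?_ ?_ ?_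
      (ih (q ∘ₗ φ ∘ₗ i) (fun t => r t.1) (fun t => d t.1) ?_ ?_ ?_) 
      (scalar (φ := LinearMap.mulLeft K _) (d s) (LinearEquiv.refl K K) fun _ => rfl)
    · intro x y hxy
      funext t
      rw [← hit x t.1 t.2, ← hit y t.1 t.2, hxy]
    · exact fun a => ⟨fun _ => a, rfl⟩
    · exact fun y => ⟨fun hy => ⟨q y, hqi y hy⟩, fun ⟨x, hx⟩ => hx ▸ his x⟩
    · intro x
      exact hqi (φ (i x)) (by rw [hlast, his, mul_zero])
    · exact hlast
    · intro t
      change φ (i (Pi.single t 1)) t.1 = _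
      rw [hisingle, hdiag]
    · intro t u hut hr
      change φ (i (Pi.single t 1)) u.1 = _
      rw [hisingle, hoff t.1 u.1 (fun h => hut (Subtype.ext h)) hr]
    · have := Fintype.card_subtype_compl (fun t => t = s)
      simp only [Fintype.card_subtype_eq] at this
      change Fintype.card {t // ¬ t = s} = N
      omega

lemma finite {M : Type} [AddCommGroup M] [Module K M] {φ : Module.End K M} {S : Multiset ℂ}
    (h : ScalarFiltered e M φ S) : Module.Finite K M := by
  induction h with
  | zero => infer_instance
  | scalar d f => exact Module.Finite.equiv f.symm
  | extension i p hi hp hip _ _ _ _ ih₁ ih₃ =>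
    exact Module.Finite.of_exact hip hp

lemma det_sub {M : Type} [AddCommGroup M] [Module ℂ M] {φ : Module.End ℂ M} {S : Multiset ℂ}
    (h : ScalarFiltered (1 : ℂ) M φ S) (a : ℂ) :
    LinearMap.det (algebraMap ℂ (Module.End ℂ M) a - φ) = (S.map fun d => a - d).prod := by
  induction h with
  | zero M φ => simp [LinearMap.det_eq_one_of_subsingleton]
  | @scalar M _ _ φ d f hφ =>
    have : algebraMap ℂ (Module.End ℂ M) a - φ = (a - d) • LinearMap.id := by
      ext x
      simp [hφ, sub_smul]
    rw [this, LinearMap.det_smul, LinearMap.det_id, f.finrank_eq]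
    simp
  | @extension M₁ M₂ M₃ _ _ _ _ _ _ φ₁ φ₂ φ₃ S₁ S₃ i p hi hp hip hφi hφp h₁ h₃ ih₁ ih₃ =>
    have := h₁.finite
    have := h₃.finite
    have : Module.Finite ℂ M₂ := Module.Finite.of_exact hip hp
    have hW : LinearMap.range i ≤
        (LinearMap.range i).comap (algebraMap ℂ (Module.End ℂ M₂) a - φ₂) := by
      rintro _ ⟨x, rfl⟩
      exact ⟨a • x - φ₁ x, by simp [hφi]⟩
    rw [LinearMap.det_eq_det_mul_det (LinearMap.range i) _ hW, Multiset.map_add,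
      Multiset.prod_add, ← ih₁, ← ih₃]
    congr 1
    · rw [← LinearMap.det_conj _ (LinearEquiv.ofInjective i hi)]
      congr 1
      ext x
      obtain ⟨x, rfl⟩ := (LinearEquiv.ofInjective i hi).surjective x
      simp [hφi]
    · let f : (M₂ ⧸ LinearMap.range i) ≃ₗ[ℂ] M₃ :=
        (Submodule.quotEquivOfEq _ _ (LinearMap.exact_iff.1 hip).symm).trans
          (p.quotKerEquivOfSurjective hp)
      have hf : ∀ x, f (Submodule.Quotient.mk x) = p x := fun x => rfl
      rw [← LinearMap.det_conj _ f]
      congr 1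
      ext x
      obtain ⟨x, rfl⟩ := f.surjective x
      obtain ⟨x, rfl⟩ := Submodule.Quotient.mk_surjective _ x
      have hx : f.symm (p x) = Submodule.Quotient.mk x := by rw [LinearEquiv.symm_apply_eq, hf]
      simp [hf, hx, hφp]

lemma add_scalar {M : Type} [AddCommGroup M] [Module ℂ M] {φ : Module.End ℂ M} {S : Multiset ℂ}
    (h : ScalarFiltered (1 : ℂ) M φ S) (d : ℂ) (ψ : Module.End ℂ M)
    (hψ : ∀ x, ψ x = d • x + φ x) :
    ScalarFiltered (1 : ℂ) M ψ (S.map fun s => d + s) := by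
  induction h with
  | zero M φ => exact zero _ _
  | scalar s f hφ => exact scalar _ f fun x => by simp [hψ, hφ, add_smul]
  | @extension M₁ M₂ M₃ _ _ _ _ _ _ φ₁ φ₂ φ₃ S₁ S₃ i p hi hp hip hφi hφp h₁ h₃ ih₁ ih₃ =>
    rw [Multiset.map_add]
    exact extension i p hi hp hip (by simp [hφi, hψ]) (by simp [hφp, hψ])
      (ih₁ (d • 1 + φ₁) (by simp)) (ih₃ (d • 1 + φ₃) (by simp))

/-- Filtrations over a filtered algebra `K` give filtrations over `ℂ`. -/
lemma tower {b : K} {T : Multiset ℂ} (hT : ScalarFiltered (1 : ℂ) K (LinearMap.mulLeft ℂ b) T)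
    {M : Type} [AddCommGroup M] [Module K M] {φ : Module.End K M} {S : Multiset ℂ}
    (h : ScalarFiltered (1 : K) M φ S) :
    ∀ [Module ℂ M] [IsScalarTower ℂ K M] (ψ : Module.End ℂ M), (∀ x, ψ x = φ x + b • x) →
      ScalarFiltered (1 : ℂ) M ψ (S.bind fun d => T.map fun t => d + t) := by
  induction h with
  | zero M φ => exact fun _ _ => zero _ _
  | scalar s f hφ =>
    intro _ _ ψ hψ
    rw [Multiset.singleton_bind]
    refine of_equiv (f.restrictScalars ℂ) ?_
      (add_scalar hT s (s • 1 + LinearMap.mulLeft ℂ b) (by simp))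
    intro x
    change f (ψ x) = s • f x + b * f x
    rw [hψ, hφ, mul_one, map_add, map_smul, map_smul, algebraMap_smul, smul_eq_mul]
  | @extension M₁ M₂ M₃ _ _ _ _ _ _ φ₁ φ₂ φ₃ S₁ S₃ i p hi hp hip hφi hφp h₁ h₃ ih₁ ih₃ =>
    intro _ _ ψ hψ
    let _ : Module ℂ M₁ := Module.compHom M₁ (algebraMap ℂ K)
    let _ : Module ℂ M₃ := Module.compHom M₃ (algebraMap ℂ K)
    have : IsScalarTower ℂ K M₁ := IsScalarTower.of_algebraMap_smul fun _ _ => rfl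
    have : IsScalarTower ℂ K M₃ := IsScalarTower.of_algebraMap_smul fun _ _ => rfl
    rw [Multiset.add_bind]
    exact extension (i.restrictScalars ℂ) (p.restrictScalars ℂ) hi hp hip
      (by simp [hφi, hψ]) (by simp [hφp, hψ])
      (ih₁ ((φ₁ + b • 1).restrictScalars ℂ) (by simp))
      (ih₃ ((φ₃ + b • 1).restrictScalars ℂ) (by simp))

/-- Cokernels of `g - φ` for a filtered endomorphism `φ`: if `g - d * e` is regular for each
scalar `d`, and the cokernels of these multiplications are filtered over `K`, then so is the
cokernel of `g - φ`. -/
lemma coker {Q : Type} [CommRing Q] [Algebra ℂ Q] [Algebra K Q] {g q ε : Q} {T : ℂ → Multiset ℂ}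
    {M : Type} [AddCommGroup M] [Module Q M] {φ : Module.End Q M} {S : Multiset ℂ}
    (h : ScalarFiltered ε M φ S)
    (hreg : ∀ d ∈ S, ∀ x : Q, (g - algebraMap ℂ Q d * ε) * x = 0 → x = 0)
    (hT : ∀ d ∈ S, ∀ (N : Type) [AddCommGroup N] [Module Q N] [Module K N] [IsScalarTower K Q N]
      (π : Q →ₗ[Q] N) (ψ : Module.End K N), Function.Surjective π →
      (∀ x, π x = 0 ↔ ∃ y, x = (g - algebraMap ℂ Q d * ε) * y) → (∀ n, ψ n = q • n) →
      ScalarFiltered e N ψ (T d)) :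
    (∀ x, g • x - φ x = 0 → x = 0) ∧
    ∀ (N : Type) [AddCommGroup N] [Module Q N] [Module K N] [IsScalarTower K Q N]
      (π : M →ₗ[Q] N) (ψ : Module.End K N), Function.Surjective π →
      (∀ x, π x = 0 ↔ ∃ y, x = g • y - φ y) → (∀ n, ψ n = q • n) →
      ScalarFiltered e N ψ (S.bind T) := by
  induction h with
  | zero M φ =>
    refine ⟨fun x _ => Subsingleton.elim _ _, fun N _ _ _ _ π ψ hπ _ _ => ?_⟩
    have := hπ.subsingleton
    exact zero _ _
  | @scalar M _ _ φ d f hφ =>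
    have hd := Multiset.mem_singleton_self d
    have hg : ∀ x, f (g • x - φ x) = (g - algebraMap ℂ Q d * ε) * f x := fun x => by
      rw [hφ, map_sub, map_smul, map_smul, smul_eq_mul, smul_eq_mul, sub_mul]
    refine ⟨fun x hx => ?_, fun N _ _ _ _ π ψ hπ hker hψ => ?_⟩
    · have := hreg d hd (f x) (by rw [← hg, hx, map_zero])
      simpa using this
    · rw [Multiset.singleton_bind]
      refine hT d hd N (π ∘ₗ f.symm.toLinearMap) ψ (hπ.comp f.symm.surjective) (fun x => ?_) hψ
      simp only [LinearMap.comp_apply, LinearEquiv.coe_coe, hker]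
      constructor
      · rintro ⟨y, hy⟩
        exact ⟨f y, by rw [← hg, ← hy, f.apply_symm_apply]⟩
      · rintro ⟨y, rfl⟩
        refine ⟨f.symm y, f.injective ?_⟩
        rw [hg, f.apply_symm_apply, f.apply_symm_apply]
  | @extension M₁ M₂ M₃ _ _ _ _ _ _ φ₁ φ₂ φ₃ S₁ S₃ i p hi hp hip hφi hφp h₁ h₃ ih₁ ih₃ =>
    obtain ⟨r₁, c₁⟩ := ih₁ (fun d hd => hreg d (Multiset.mem_add.2 (.inl hd)))
      (fun d hd => hT d (Multiset.mem_add.2 (.inl hd)))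
    obtain ⟨r₃, c₃⟩ := ih₃ (fun d hd => hreg d (Multiset.mem_add.2 (.inr hd)))
      (fun d hd => hT d (Multiset.mem_add.2 (.inr hd)))
    have lift : ∀ x, g • p x - φ₃ (p x) = 0 → ∃ x', i x' = x := fun x hx =>
      (hip x).1 (r₃ _ hx)
    refine ⟨fun x hx => ?_, fun N _ _ _ _ π ψ hπ hker hψ => ?_⟩
    · obtain ⟨x, rfl⟩ := lift x (by rw [← hφp, ← map_smul, ← map_sub, hx, map_zero])
      rw [← hφi, ← map_smul, ← map_sub] at hx
      rw [r₁ x (hi (by rw [hx, map_zero])), map_zero]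
    · let N₁ : Submodule Q N := LinearMap.range (π ∘ₗ i)
      obtain ⟨π₃, hπ₃⟩ : ∃ π₃ : M₃ →ₗ[Q] N ⧸ N₁, ∀ x, π₃ (p x) = N₁.mkQ (π x) := by
        refine ⟨(LinearMap.ker p).liftQ (N₁.mkQ ∘ₗ π) ?_ ∘ₗ
          (p.quotKerEquivOfSurjective hp).symm.toLinearMap, fun x => ?_⟩
        · intro x hx
          obtain ⟨x, rfl⟩ := (hip x).1 hx
          exact (Submodule.Quotient.mk_eq_zero _).2 ⟨x, rfl⟩
        · have : p x = p.quotKerEquivOfSurjective hp (Submodule.Quotient.mk x) := rfl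
          rw [LinearMap.comp_apply, LinearEquiv.coe_coe, this, LinearEquiv.symm_apply_apply]
          rfl
      rw [Multiset.add_bind]
      refine extension (φ₁ := Algebra.lsmul K K N₁ q) (φ₃ := Algebra.lsmul K K (N ⧸ N₁) q)
        (N₁.subtype.restrictScalars K) (N₁.mkQ.restrictScalars K)
        N₁.subtype_injective N₁.mkQ_surjective ?_ ?_ ?_
        (c₁ N₁ (LinearMap.rangeRestrict (π ∘ₗ i)) _ (LinearMap.surjective_rangeRestrict _) ?_
          fun _ => rfl)
        (c₃ (N ⧸ N₁) π₃ _ ?_ ?_ fun _ => rfl)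
      · intro x
        simp
      · intro x
        simp [hψ]
      · intro x
        simp [hψ]
      · intro x
        rw [← Subtype.coe_inj]
        change π (i x) = 0 ↔ _
        rw [hker]
        constructor
        · rintro ⟨y, hy⟩
          obtain ⟨y, rfl⟩ := lift y (by
            rw [← hφp, ← map_smul, ← map_sub, ← hy]
            exact (hip _).2 ⟨x, rfl⟩)
          exact ⟨y, hi (by rw [hy, map_sub, map_smul, hφi])⟩
        · rintro ⟨y, rfl⟩
          exact ⟨i y, by rw [map_sub, map_smul, hφi]⟩
      · intro x
        obtain ⟨x, rfl⟩ := N₁.mkQ_surjective x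
        obtain ⟨x, rfl⟩ := hπ x
        exact ⟨p x, hπ₃ x⟩
      · intro x
        obtain ⟨x, rfl⟩ := hp x
        rw [hπ₃, Submodule.mkQ_apply, Submodule.Quotient.mk_eq_zero]
        constructor
        · rintro ⟨m, hm⟩
          obtain ⟨y, hy⟩ := (hker (x - i m)).1 (by
            rw [map_sub, sub_eq_zero]
            exact hm.symm)
          refine ⟨p y, ?_⟩
          rw [← hφp, ← map_smul, ← map_sub, ← hy, map_sub, (hip _).2 ⟨m, rfl⟩, sub_zero]
        · rintro ⟨y, hy⟩
          obtain ⟨y, rfl⟩ := hp y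
          obtain ⟨m, hm⟩ := (hip (x - (g • y - φ₂ y))).1 (by
            rw [map_sub, map_sub, map_smul, hφp, hy, sub_self])
          refine ⟨m, ?_⟩
          have := (hker (g • y - φ₂ y)).2 ⟨y, rfl⟩
          rw [LinearMap.comp_apply, hm, map_sub, this, sub_zero]

end ScalarFiltered

end ScalarFiltered

section EdgeAlgebra

variable {ι : Type} [Fintype ι] [DecidableEq ι] {K : Type} [CommRing K] [Algebra ℂ K]

/-- The relation `c_j x_j^{|ι|} = w ∏_{i ≠ j} x_i` attached to the vertex `j` of an edge consisting
of `ι` and one further vertex of value `w`. -/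
noncomputable def edgeRel (w : K) (c : ι → ℂ) (j : ι) : MvPolynomial ι K :=
  C (algebraMap ℂ K (c j)) * X j ^ Fintype.card ι - C w * ∏ i ∈ univ.erase j, X i

/-- The ideal generated by the relations attached to the vertices in `J`. -/
noncomputable def edgeIdeal (w : K) (c : ι → ℂ) (J : Finset ι) : Ideal (MvPolynomial ι K) :=
  Ideal.span (Set.image (edgeRel w c) J)

/-- The scalar picked up by a sequence of topplings. -/
noncomputable def toppleWeight (w : K) (c : ι → ℂ) (N : ι →₀ ℕ) : K :=
  ∏ j, (algebraMap ℂ K (c j)⁻¹ * w) ^ N j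

lemma toppleWeight_add (w : K) (c : ι → ℂ) (N N' : ι →₀ ℕ) :
    toppleWeight w c (N + N') = toppleWeight w c N * toppleWeight w c N' := by
  simp [toppleWeight, pow_add, Finset.prod_mul_distrib]

lemma toppleWeight_zero (w : K) (c : ι → ℂ) : toppleWeight w c 0 = 1 := by
  simp [toppleWeight]

lemma toppleWeight_single (w : K) (c : ι → ℂ) (j : ι) :
    toppleWeight w c (Finsupp.single j 1) = algebraMap ℂ K (c j)⁻¹ * w := by
  rw [toppleWeight, Finset.prod_eq_single j]
  · simp
  · intro i _ hi
    simp [hi.symm]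
  · simp

lemma toppleWeight_onesConfig (w : K) (c : ι → ℂ) :
    toppleWeight w c (onesConfig ι) = algebraMap ℂ K (∏ j, c j)⁻¹ * w ^ Fintype.card ι := by
  simp only [toppleWeight, onesConfig_apply, pow_one]
  rw [Finset.prod_mul_distrib, Finset.prod_const, Finset.card_univ, ← map_prod,
    Finset.prod_inv_distrib]

lemma prod_erase_X (j : ι) :
    ∏ i ∈ univ.erase j, (X i : MvPolynomial ι K) = monomial (onesExcept j) 1 := by
  rw [onesExcept, monomial_sum_one]
  rfl

lemma prod_univ_X : ∏ i : ι, (X i : MvPolynomial ι K) = monomial (onesConfig ι) 1 := by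
  rw [onesConfig, monomial_sum_one]
  rfl

lemma monomial_mul_edgeRel (w : K) (c : ι → ℂ) (j : ι) (β : ι →₀ ℕ) (a : K) :
    monomial β a * edgeRel w c j =
      monomial (β + Finsupp.single j (Fintype.card ι)) (a * algebraMap ℂ K (c j)) -
        monomial (β + onesExcept j) (a * w) := by
  rw [edgeRel, prod_erase_X, X_pow_eq_monomial, C_mul_monomial, C_mul_monomial, mul_sub,
    monomial_mul, monomial_mul, mul_one, mul_one]

/-- The normal form of a polynomial modulo `edgeIdeal w c J`. -/
noncomputable def normalForm (w : K) (c : ι → ℂ) (J : Finset ι) :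
    MvPolynomial ι K →ₗ[K] MvPolynomial ι K :=
  (basisMonomials ι K).constr K fun α =>
    monomial (stab J α).1 (toppleWeight w c (stab J α).2)

variable {w : K} {c : ι → ℂ} {J : Finset ι}

lemma normalForm_monomial (α : ι →₀ ℕ) (a : K) :
    normalForm w c J (monomial α a) =
      monomial (stab J α).1 (a * toppleWeight w c (stab J α).2) := by
  have h : monomial α a = a • basisMonomials ι K α := by
    rw [coe_basisMonomials, smul_monomial, smul_eq_mul, mul_one]
  rw [h, map_smul, normalForm, Module.Basis.constr_basis, smul_monomial, smul_eq_mul]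

lemma normalForm_topple (j : ι) (hj : j ∈ J) (β : ι →₀ ℕ) (a : K) :
    normalForm w c J (monomial (β + Finsupp.single j (Fintype.card ι)) a) =
      normalForm w c J (monomial (β + onesExcept j) (a * (algebraMap ℂ K (c j)⁻¹ * w))) := by
  rw [normalForm_monomial, normalForm_monomial, stab_topple j hj, Prod.fst_add, Prod.snd_add,
    toppleWeight_add, toppleWeight_single, add_zero]
  congr 1
  ring

lemma algebraMap_inv_mul_cancel {x : ℂ} (hx : x ≠ 0) :
    algebraMap ℂ K x⁻¹ * algebraMap ℂ K x = 1 := by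
  rw [← map_mul, inv_mul_cancel₀ hx, map_one]

lemma normalForm_sub_mem (hc : ∀ j ∈ J, c j ≠ 0) (p : MvPolynomial ι K) :
    normalForm w c J p - p ∈ edgeIdeal w c J := by
  induction p using MvPolynomial.induction_on' with
  | monomial α a =>
    induction α using topple_induction (J := J) generalizing a with
    | stable α h =>
      rw [normalForm_monomial, stab_of_stable h]
      simp [toppleWeight_zero]
    | topple j hj β ih =>
      have h1 := ih (a * (algebraMap ℂ K (c j)⁻¹ * w))
      rw [← normalForm_topple j hj] at h1
      have h2 : monomial β (a * algebraMap ℂ K (c j)⁻¹) * edgeRel w c j ∈ edgeIdeal w c J :=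
        Ideal.mul_mem_left _ _ (Ideal.subset_span ⟨j, hj, rfl⟩)
      rw [monomial_mul_edgeRel, mul_assoc, algebraMap_inv_mul_cancel (hc j hj), mul_one,
        mul_assoc] at h2
      simpa using sub_mem h1 h2
  | add p q hp hq =>
    rw [map_add, add_sub_add_comm]
    exact add_mem hp hq

lemma normalForm_mul_edgeRel (hc : ∀ j ∈ J, c j ≠ 0) {j : ι} (hj : j ∈ J) (p : MvPolynomial ι K) :
    normalForm w c J (p * edgeRel w c j) = 0 := by
  induction p using MvPolynomial.induction_on' with
  | monomial β a =>
    rw [monomial_mul_edgeRel, map_sub, normalForm_topple j hj, ← map_sub,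
      show a * algebraMap ℂ K (c j) * (algebraMap ℂ K (c j)⁻¹ * w) =
        a * w * (algebraMap ℂ K (c j)⁻¹ * algebraMap ℂ K (c j)) by ring,
      algebraMap_inv_mul_cancel (hc j hj), mul_one, sub_self, map_zero]
  | add p q hp hq => rw [add_mul, map_add, hp, hq, add_zero]

lemma mem_edgeIdeal_iff (hc : ∀ j ∈ J, c j ≠ 0) {p : MvPolynomial ι K} :
    p ∈ edgeIdeal w c J ↔ normalForm w c J p = 0 := by
  constructor
  · intro hp
    suffices ∀ q, normalForm w c J (q * p) = 0 by simpa using this 1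
    induction hp using Submodule.span_induction with
    | mem x hx =>
      obtain ⟨j, hj, rfl⟩ := hx
      exact fun q => normalForm_mul_edgeRel hc hj q
    | zero => simp
    | add x y _ _ hx hy => intro q; rw [mul_add, map_add, hx, hy, add_zero]
    | smul a x _ hx => intro q; rw [smul_eq_mul, ← mul_assoc, hx]
  · intro hp
    have := normalForm_sub_mem (w := w) hc p
    rw [hp, zero_sub] at this
    exact neg_mem_iff.1 this

lemma normalForm_of_stable {α : ι →₀ ℕ} (h : ∀ j ∈ J, α j < Fintype.card ι) (a : K) :
    normalForm w c J (monomial α a) = monomial α a := by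
  rw [normalForm_monomial, stab_of_stable h, toppleWeight_zero, mul_one]

lemma totalDegree_normalForm_le (p : MvPolynomial ι K) :
    (normalForm w c J p).totalDegree ≤ p.totalDegree := by
  conv_lhs => rw [p.as_sum, map_sum]
  refine totalDegree_finsetSum_le fun α hα => ?_
  rw [normalForm_monomial]
  refine (totalDegree_monomial_le _ _).trans ((degree_stab_le α).trans ?_)
  exact le_totalDegree hα

lemma normalForm_monomial_single_mul {v : ι} (hv : v ∉ J) (N : ℕ) (p : MvPolynomial ι K) :
    normalForm w c J (monomial (Finsupp.single v N) 1 * p) =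
      monomial (Finsupp.single v N) 1 * normalForm w c J p := by
  induction p using MvPolynomial.induction_on' with
  | monomial β a =>
    rw [monomial_mul, add_comm, normalForm_monomial, stab_add_single_of_notMem hv,
      normalForm_monomial, monomial_mul, Prod.fst_add, Prod.snd_add, add_zero, one_mul, one_mul,
      add_comm]
  | add p q hp hq => rw [mul_add, map_add, hp, hq, map_add, mul_add]

/-- The relation of the last vertex is regular modulo the others. -/
lemma mem_edgeIdeal_of_edgeRel_mul {v : ι} (hc : ∀ j, c j ≠ 0) {p : MvPolynomial ι K}
    (hp : edgeRel w c v * p ∈ edgeIdeal w c (univ.erase v)) :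
    p ∈ edgeIdeal w c (univ.erase v) := by
  have hL : 0 < Fintype.card ι := Fintype.card_pos_iff.2 ⟨v⟩
  have hc' : ∀ j ∈ univ.erase v, c j ≠ 0 := fun j _ => hc j
  set q := normalForm w c (univ.erase v) p with hq
  have hpq : edgeRel w c v * q ∈ edgeIdeal w c (univ.erase v) := by
    have := add_mem (Ideal.mul_mem_left _ (edgeRel w c v) (normalForm_sub_mem (w := w) hc' p)) hp
    rwa [mul_sub, sub_add_cancel] at this
  have hqq : normalForm w c (univ.erase v) q = q := by
    have := (mem_edgeIdeal_iff hc').1 (normalForm_sub_mem (w := w) hc' p)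
    rwa [map_sub, sub_eq_zero] at this
  rw [mem_edgeIdeal_iff hc', ← hq]
  rw [mem_edgeIdeal_iff hc', edgeRel, sub_mul, map_sub, sub_eq_zero, X_pow_eq_monomial, mul_assoc,
    mul_assoc, ← smul_eq_C_mul, ← smul_eq_C_mul, map_smul, map_smul,
    normalForm_monomial_single_mul (by simp), hqq, prod_erase_X] at hpq
  by_contra hne
  obtain ⟨α, hα, hdeg⟩ := Finset.exists_mem_eq_sup q.support
    (support_nonempty.2 hne) Finsupp.degree
  have htd : q.totalDegree = α.degree := by
    rw [← hdeg]
    rfl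
  have h1 : coeff (α + Finsupp.single v (Fintype.card ι))
      (w • normalForm w c (univ.erase v) (monomial (onesExcept v) 1 * q)) = 0 := by
    rw [coeff_smul]
    rw [coeff_eq_zero_of_totalDegree_lt, smul_zero]
    refine lt_of_le_of_lt ((totalDegree_normalForm_le _).trans (totalDegree_mul _ _)) ?_
    have := totalDegree_monomial_le (onesExcept v) (1 : K)
    change _ < (α + Finsupp.single v (Fintype.card ι)).degree
    rw [map_add, Finsupp.degree_single, htd]
    have h2 := degree_onesExcept v
    change _ ≤ (onesExcept v).degree at this
    omega
  rw [← hpq, coeff_smul, add_comm, coeff_monomial_mul, one_mul, smul_eq_mul] at h1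
  apply mem_support_iff.1 hα
  rw [← one_mul (coeff α q), ← algebraMap_inv_mul_cancel (hc v), mul_assoc, h1, mul_zero]

end EdgeAlgebra

section EdgeFiltration

variable {ι : Type} [Fintype ι] [DecidableEq ι] {K : Type} [CommRing K] [Algebra ℂ K]
variable {w : K} {c : ι → ℂ}

/-- A bounded function seen as a chip configuration. -/
noncomputable def toConfig (s : ι → Fin (Fintype.card ι)) : ι →₀ ℕ :=
  Finsupp.equivFunOnFinite.symm fun j => (s j : ℕ)

lemma toConfig_lt (s : ι → Fin (Fintype.card ι)) (j : ι) : toConfig s j < Fintype.card ι :=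
  (s j).2

lemma toConfig_injective : Function.Injective (toConfig (ι := ι)) := by
  intro s t h
  funext j
  exact Fin.ext (DFunLike.congr_fun h j)

lemma exists_toConfig {α : ι →₀ ℕ} (h : ∀ j, α j < Fintype.card ι) : ∃ s, toConfig s = α :=
  ⟨fun j => ⟨α j, h j⟩, by ext j; rfl⟩

/-- The multiset of the scalars `d` for which multiplication by the product of the variables
acts as the scalar `d * w ^ |ι|` on the algebra of an edge with coefficients of product `a`. -/
noncomputable def edgeScalars (L : ℕ) (a : ℂ) : Multiset ℂ :=
  Multiset.replicate ((L + 1) ^ (L - 1)) a⁻¹ + Multiset.replicate (L ^ L - (L + 1) ^ (L - 1)) 0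

lemma exists_isRecurrent_stab (α : ι →₀ ℕ) :
    ∃ N : ℕ, IsRecurrent (stab univ (α + N • onesConfig ι)).1 :=
  ⟨Fintype.card ι, isRecurrent_stab α⟩

open Classical in
/-- The number of steps after which a configuration becomes recurrent. -/
noncomputable def recurrenceTime (α : ι →₀ ℕ) : ℕ := Nat.find (exists_isRecurrent_stab α)

lemma recurrenceTime_lt {α : ι →₀ ℕ} (hα : ∀ j, α j < Fintype.card ι) (h : ¬ IsRecurrent α) :
    recurrenceTime (stab univ (α + onesConfig ι)).1 < recurrenceTime α := by
  classical
  have hspec := Nat.find_spec (exists_isRecurrent_stab α)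
  change IsRecurrent (stab univ (α + recurrenceTime α • onesConfig ι)).1 at hspec
  generalize recurrenceTime α = N at hspec
  cases N with
  | zero =>
    rw [zero_smul, add_zero, stab_of_stable fun j _ => hα j] at hspec
    exact absurd hspec h
  | succ N =>
    refine Nat.lt_succ_of_le (Nat.find_min' _ ?_)
    rw [add_smul, one_smul, add_comm (N • _), ← add_assoc, stab_add] at hspec
    simpa using hspec

/-- Multiplication by the product of the variables on the algebra of an edge. -/
lemma scalarFiltered_edge [Nonempty ι] (hc : ∀ j, c j ≠ 0) {N : Type} [AddCommGroup N]
    [Module K N] (π : MvPolynomial ι K →ₗ[K] N) (ψ : Module.End K N)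
    (hπ : Function.Surjective π) (hker : ∀ p, π p = 0 ↔ p ∈ edgeIdeal w c univ)
    (hψ : ∀ p, ψ (π p) = π ((∏ i, X i) * p)) :
    ScalarFiltered (w ^ Fintype.card ι) N ψ (edgeScalars (Fintype.card ι) (∏ j, c j)) := by
  classical
  have hc' : ∀ j ∈ univ, c j ≠ 0 := fun j _ => hc j
  have hnf : ∀ p, π p = π (normalForm w c univ p) := by
    intro p
    rw [eq_comm, ← sub_eq_zero, ← map_sub, hker]
    exact normalForm_sub_mem hc' p
  let f₀ : ((ι → Fin (Fintype.card ι)) → K) →ₗ[K] N :=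
    Fintype.linearCombination K fun s => π (monomial (toConfig s) 1)
  have hf₀ : ∀ x, f₀ x = π (∑ s, monomial (toConfig s) (x s)) := by
    intro x
    simp only [f₀, Fintype.linearCombination_apply, map_sum, ← map_smul, smul_eq_mul,
      mul_one]
  have hinj : Function.Injective f₀ := by
    rw [← LinearMap.ker_eq_bot, LinearMap.ker_eq_bot']
    intro x hx
    rw [hf₀, hker, mem_edgeIdeal_iff hc', map_sum] at hx
    funext t
    have := congrArg (coeff (toConfig t)) hx
    rw [coeff_sum, Finset.sum_eq_single t] at this
    · simpa [normalForm_of_stable fun j _ => toConfig_lt t j] using this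
    · intro s _ hst
      rw [normalForm_of_stable fun j _ => toConfig_lt s j, coeff_monomial,
        if_neg fun h => hst (toConfig_injective h)]
    · simp
  have hsingle : ∀ s, f₀ (Pi.single s 1) = π (monomial (toConfig s) 1) := by
    intro s
    simp [f₀]
  have hsurj : Function.Surjective f₀ := by
    rw [← LinearMap.range_eq_top, eq_top_iff]
    rintro n -
    obtain ⟨p, rfl⟩ := hπ n
    induction p using MvPolynomial.induction_on' with
    | monomial α a =>
      obtain ⟨s, hs⟩ := exists_toConfig fun j => stab_fst_lt α j (mem_univ j)
      rw [hnf, normalForm_monomial, ← hs, ← mul_one (a * _), ← smul_eq_mul, ← smul_monomial,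
        map_smul, ← hsingle]
      exact Submodule.smul_mem _ _ ⟨_, rfl⟩
    | add p q hp hq =>
      rw [map_add]
      exact add_mem hp hq
  let f := LinearEquiv.ofBijective f₀ ⟨hinj, hsurj⟩
  have hf : ∀ s, f (Pi.single s 1) = π (monomial (toConfig s) 1) := hsingle
  choose τ hτ using fun s : ι → Fin (Fintype.card ι) =>
    exists_toConfig fun j => stab_fst_lt (toConfig s + onesConfig ι) j (mem_univ j)
  let φ : Module.End K ((ι → Fin (Fintype.card ι)) → K) := f.symm.toLinearMap ∘ₗ ψ ∘ₗ f.toLinearMap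
  have hφ : ∀ s, φ (Pi.single s 1) =
      toppleWeight w c (stab univ (toConfig s + onesConfig ι)).2 • Pi.single (τ s) 1 := by
    intro s
    apply f.injective
    change f (f.symm (ψ (f (Pi.single s 1)))) = _
    rw [f.apply_symm_apply, hf, hψ, map_smul, hf, prod_univ_X, monomial_mul, hnf,
      normalForm_monomial, add_comm (onesConfig ι), ← hτ, one_mul, one_mul, ← map_smul,
      smul_monomial, smul_eq_mul, mul_one]
  have hrec : ∀ s, IsRecurrent (toConfig s) ↔ τ s = s := by
    intro s
    rw [← toConfig_injective.eq_iff, hτ]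
    rfl
  have hS : edgeScalars (Fintype.card ι) (∏ j, c j) =
      ∑ s : ι → Fin (Fintype.card ι), {if IsRecurrent (toConfig s) then (∏ j, c j)⁻¹ else 0} := by
    have h1 : ∀ s : ι → Fin (Fintype.card ι),
        ({if IsRecurrent (toConfig s) then (∏ j, c j)⁻¹ else 0} : Multiset ℂ) =
          if IsRecurrent (toConfig s) then {(∏ j, c j)⁻¹} else {0} := fun s => by split_ifs <;> rfl
    have h2 := card_recurrent (ι := ι)
    have h3 := Finset.card_filter_add_card_filter_not
      (s := (univ : Finset (ι → Fin (Fintype.card ι)))) (fun s => IsRecurrent (toConfig s))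
    change (univ.filter fun s => IsRecurrent (toConfig s)).card = _ at h2
    rw [Finset.card_univ, Fintype.card_fun, Fintype.card_fin] at h3
    rw [Finset.sum_congr rfl fun s _ => h1 s, Finset.sum_ite, Finset.sum_const, Finset.sum_const,
      Multiset.nsmul_singleton, Multiset.nsmul_singleton, edgeScalars, h2]
    congr 2
    omega
  rw [hS]
  refine ScalarFiltered.of_equiv f.symm (φ := φ) (fun n => by simp [φ])
    (ScalarFiltered.of_triangular φ (fun s => recurrenceTime (toConfig s)) _ ?_ ?_)
  · intro s
    rw [hφ]
    split_ifs with h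
    · rw [h.odometer, (hrec s).1 h, toppleWeight_onesConfig]
      simp
    · have : s ≠ τ s := fun h' => h ((hrec s).2 h'.symm)
      simp [this]
  · intro s t hts hr
    rw [hφ]
    have : t ≠ τ s := by
      rintro rfl
      have := recurrenceTime_lt (toConfig_lt s) (fun h => hts ((hrec s).1 h))
      rw [← hτ] at this
      omega
    simp [this]

end EdgeFiltration

section Branch

variable {ι : Type} [Fintype ι] [DecidableEq ι]

/-- The product of the coordinates of the first edge of a branch of length `n`. -/
def firstProd {R : Type} [CommRing R] (n : ℕ) (x : ℕ → ι → R) : R :=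
  if n = 0 then 0 else ∏ i, x 0 i

/-- The eigenvalue equations of a branch of length `n` with edges consisting of copies of `ι`
and the vertex `v₀` of the previous edge, where the initial vertex has value `w`. -/
def IsBranch {R : Type} [CommRing R] (v₀ : ι) (lam : R) : ℕ → R → (ℕ → ι → R) → Prop
  | 0, _, _ => True
  | n + 1, w, x =>
    (∀ j, lam * x 0 j ^ Fintype.card ι = w * ∏ i ∈ univ.erase j, x 0 i +
      if j = v₀ then firstProd n (fun t => x (t + 1)) else 0) ∧
    IsBranch v₀ lam n (x 0 v₀) fun t => x (t + 1)

lemma map_firstProd {R S : Type} [CommRing R] [CommRing S] (f : R →+* S) (n : ℕ) (x : ℕ → ι → R) :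
    f (firstProd n x) = firstProd n fun t j => f (x t j) := by
  unfold firstProd
  split_ifs <;> simp

lemma firstProd_congr {R : Type} [CommRing R] {n : ℕ} {x y : ℕ → ι → R}
    (h : ∀ t < n, ∀ j, x t j = y t j) : firstProd n x = firstProd n y := by
  unfold firstProd
  split_ifs with hn
  · rfl
  · exact prod_congr rfl fun j _ => h 0 (by omega) j

lemma IsBranch.map {R S : Type} [CommRing R] [CommRing S] (f : R →+* S) {v₀ : ι} {lam : R} {n : ℕ}
    {w : R} {x : ℕ → ι → R} (h : IsBranch v₀ lam n w x) :
    IsBranch v₀ (f lam) n (f w) fun t j => f (x t j) := by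
  induction n generalizing w x with
  | zero => trivial
  | succ n ih =>
    refine ⟨fun j => ?_, ih h.2⟩
    have := congrArg f (h.1 j)
    rw [map_mul, map_pow, map_add, map_mul, map_prod, apply_ite f, map_firstProd, map_zero] at this
    exact this

/-- The scalars by which the product of the coordinates of the first edge of a branch acts. -/
noncomputable def branchScalars (L : ℕ) (lam : ℂ) : ℕ → Multiset ℂ
  | 0 => {0}
  | n + 1 => (branchScalars L lam n).bind fun d => edgeScalars L (lam ^ (L - 1) * (lam - d))

lemma edgeIdeal_insert {K : Type} [CommRing K] [Algebra ℂ K] (w : K) (c : ι → ℂ) (v₀ : ι) :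
    edgeIdeal w c univ = Ideal.span {edgeRel w c v₀} ⊔ edgeIdeal w c (univ.erase v₀) := by
  rw [edgeIdeal, edgeIdeal, ← Ideal.span_union, ← Set.image_singleton, ← Set.image_union,
    ← Finset.coe_singleton, ← Finset.coe_union, ← Finset.insert_eq,
    Finset.insert_erase (mem_univ v₀)]

lemma exists_lift_of_surjective {R S T : Type} [CommRing R] [CommRing S] [CommRing T]
    {f : R →+* S} (hf : Function.Surjective f) (g : R →+* T) (h : ∀ a, f a = 0 → g a = 0) :
    ∃ g' : S →+* T, ∀ a, g' (f a) = g a :=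
  ⟨RingHom.liftOfSurjective f hf ⟨g, fun a ha => h a ha⟩, fun a =>
    RingHom.liftOfRightInverse_comp_apply _ _ _ _ a⟩

lemma edgeIdeal_congr {K : Type} [CommRing K] [Algebra ℂ K] {w : K} {c c' : ι → ℂ} {J : Finset ι}
    (h : ∀ j ∈ J, c j = c' j) : edgeIdeal w c J = edgeIdeal w c' J := by
  rw [edgeIdeal, edgeIdeal]
  congr 1
  exact Set.image_congr fun j hj => by rw [edgeRel, edgeRel, h j hj]

/-- The universal algebra of a branch, with the filtration of multiplication by the product of
the coordinates of its first edge. -/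
theorem exists_branchAlgebra (v₀ : ι) {lam : ℂ} (hlam : lam ≠ 0) (n : ℕ)
    (hd : ∀ s < n, ∀ d ∈ branchScalars (Fintype.card ι) lam s, lam - d ≠ 0) :
    ∀ (K : Type) [CommRing K] [Algebra ℂ K] (w : K),
      ∃ (A : Type) (_ : CommRing A) (_ : Algebra K A) (x : ℕ → ι → A),
        IsBranch v₀ (algebraMap K A (algebraMap ℂ K lam)) n (algebraMap K A w) x ∧
        (∀ (S : Type) [CommRing S] (f : K →+* S) (x' : ℕ → ι → S),
          IsBranch v₀ (f (algebraMap ℂ K lam)) n (f w) x' →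
          ∃ g : A →+* S, (∀ a, g (algebraMap K A a) = f a) ∧
            ∀ t < n, ∀ j, g (x t j) = x' t j) ∧
        (∀ (S : Type) [CommRing S] (g g' : A →+* S),
          (∀ a, g (algebraMap K A a) = g' (algebraMap K A a)) →
          (∀ t < n, ∀ j, g (x t j) = g' (x t j)) → g = g') ∧
        ScalarFiltered (w ^ Fintype.card ι) A (LinearMap.mulLeft K (firstProd n x))
          (branchScalars (Fintype.card ι) lam n) := by
  have : Nonempty ι := ⟨v₀⟩
  induction n with
  | zero =>
    intro K _ _ w
    refine ⟨K, inferInstance, inferInstance, fun _ _ => 0, trivial, ?_, ?_, ?_⟩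
    · exact fun S _ f x' _ => ⟨f, fun _ => rfl, fun t ht => absurd ht (by omega)⟩
    · exact fun S _ g g' h _ => RingHom.ext h
    · exact .scalar 0 (LinearEquiv.refl K K) fun x => by simp [firstProd]
  | succ n ih =>
    intro K _ _ w
    set I := edgeIdeal w (fun _ : ι => lam) (univ.erase v₀) with hI
    obtain ⟨Q, _, _, _, _, mkI, hIsurj, hIker⟩ : ∃ (Q : Type) (_ : CommRing Q) (_ : Algebra K Q)
        (_ : Algebra ℂ Q) (_ : IsScalarTower ℂ K Q) (mkI : MvPolynomial ι K →ₐ[K] Q),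
        Function.Surjective mkI ∧ ∀ p, mkI p = 0 ↔ p ∈ I :=
      ⟨MvPolynomial ι K ⧸ I, inferInstance, inferInstance, inferInstance, inferInstance,
        Ideal.Quotient.mkₐ K I, Ideal.Quotient.mk_surjective,
        fun p => Ideal.Quotient.eq_zero_iff_mem⟩
    set u : ι → Q := fun i => mkI (X i) with hu
    set g : Q := mkI (edgeRel w (fun _ => lam) v₀) with hg
    obtain ⟨A', _, _, x', hx', hex', huniq', hfil'⟩ :=
      ih (fun s hs => hd s (by omega)) Q (u v₀)
    set y' := firstProd n x' with hy'
    obtain ⟨A, _, _, mkJ, hJsurj, hJker⟩ : ∃ (A : Type) (_ : CommRing A) (_ : Algebra Q A)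
        (mkJ : A' →ₐ[Q] A), Function.Surjective mkJ ∧
        ∀ x, mkJ x = 0 ↔ ∃ z, x = (algebraMap Q A' g - y') * z :=
      ⟨A' ⧸ Ideal.span {algebraMap Q A' g - y'}, inferInstance, inferInstance,
        Ideal.Quotient.mkₐ Q _, Ideal.Quotient.mk_surjective,
        fun p => Ideal.Quotient.eq_zero_iff_mem.trans Ideal.mem_span_singleton⟩
    let _ : Algebra K A := ((algebraMap Q A).comp (algebraMap K Q)).toAlgebra
    have : IsScalarTower K Q A := IsScalarTower.of_algebraMap_eq' rfl
    let x : ℕ → ι → A := fun t j => match t with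
      | 0 => algebraMap Q A (u j)
      | t + 1 => mkJ (x' t j)
    have hx0 : ∀ j, x 0 j = algebraMap Q A (u j) := fun j => rfl
    have hxs : ∀ t j, x (t + 1) j = mkJ (x' t j) := fun t j => rfl
    have halg : ∀ a, algebraMap K A a = algebraMap Q A (algebraMap K Q a) := fun a => rfl
    have hgy : algebraMap Q A g = mkJ y' := by
      rw [← mkJ.commutes, ← sub_eq_zero, ← map_sub, hJker]
      exact ⟨1, (mul_one _).symm⟩
    have hrel : ∀ (c : ι → ℂ) (j : ι), mkI (edgeRel w c j) =
        algebraMap ℂ Q (c j) * u j ^ Fintype.card ι -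
          algebraMap K Q w * ∏ i ∈ univ.erase j, u i := fun c j => by
      rw [edgeRel, map_sub, map_mul, map_mul, map_pow, map_prod, ← algebraMap_eq, mkI.commutes,
        mkI.commutes, ← IsScalarTower.algebraMap_apply]
    have hrel0 : ∀ j ≠ v₀, mkI (edgeRel w (fun _ => lam) j) = 0 := fun j hj =>
      (hIker _).2 (Ideal.subset_span ⟨j, by simp [hj], rfl⟩)
    have hyA : firstProd n (fun t => x (t + 1)) = algebraMap Q A g := by
      rw [hgy]
      exact (map_firstProd (mkJ : A' →+* A) n x').symm
    refine ⟨A, inferInstance, inferInstance, x, ⟨fun j => ?_, ?_⟩, ?_, ?_, ?_⟩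
    · have h1 := congrArg (algebraMap Q A) (hrel (fun _ => lam) j)
      simp only [map_sub, map_mul, map_pow, map_prod] at h1
      simp only [hx0, halg]
      rw [hyA, ← IsScalarTower.algebraMap_apply ℂ K Q, ← sub_eq_iff_eq_add', ← h1]
      split_ifs with hj
      · rw [hj]
      · rw [hrel0 j hj, map_zero]
    · have := hx'.map (mkJ : A' →+* A)
      simp only [RingHom.coe_coe, AlgHom.commutes] at this
      rw [halg, ← IsScalarTower.algebraMap_apply ℂ K Q]
      exact this
    · intro S _ f x'' hx''
      have hev : ∀ j, eval₂Hom f (x'' 0) (edgeRel w (fun _ => lam) j) =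
          if j = v₀ then firstProd n (fun t => x'' (t + 1)) else 0 := by
        intro j
        rw [edgeRel, map_sub, map_mul, map_mul, map_pow, map_prod, sub_eq_iff_eq_add']
        simpa using hx''.1 j
      obtain ⟨fQ, hfQ⟩ := exists_lift_of_surjective (f := (mkI : MvPolynomial ι K →+* Q)) hIsurj
        (eval₂Hom f (x'' 0)) (by
          intro p hp
          have hp := (hIker p).1 hp
          change p ∈ RingHom.ker _
          refine Ideal.span_le.2 ?_ hp
          rintro _ ⟨j, hj, rfl⟩
          change _ = _
          rw [hev, if_neg (by simpa using hj)])
      have hfu : ∀ j, fQ (u j) = x'' 0 j := fun j => by simpa using hfQ (X j)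
      have hfK : ∀ a, fQ (algebraMap K Q a) = f a := fun a => by
        have := hfQ (C a)
        rw [RingHom.coe_coe, ← algebraMap_eq, mkI.commutes] at this
        simpa using this
      have hb := hx''.2
      rw [← hfK, ← IsScalarTower.algebraMap_apply, ← hfu] at hb
      obtain ⟨h, hhQ, hhx⟩ := hex' S fQ _ hb
      obtain ⟨hA, hhA⟩ := exists_lift_of_surjective (f := (mkJ : A' →+* A)) hJsurj h (by
          intro z hz
          obtain ⟨z, rfl⟩ := (hJker z).1 hz
          have h2 := (hfQ _).trans (hev v₀)
          rw [if_pos rfl] at h2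
          change fQ g = _ at h2
          rw [map_mul, map_sub, hhQ, h2, hy', map_firstProd, firstProd_congr hhx, sub_self,
            zero_mul])
      have hhA' : ∀ q, hA (algebraMap Q A q) = fQ q := fun q => by
        rw [← mkJ.commutes, ← hhQ]; exact hhA _
      refine ⟨hA, fun a => by rw [halg, hhA', hfK], fun t ht j => ?_⟩
      cases t with
      | zero => rw [hx0, hhA', hfu]
      | succ t => rw [hxs, ← hhx t (by omega)]; exact hhA _
    · intro S _ h h' hK hxx
      have hQ : h.comp (algebraMap Q A) = h'.comp (algebraMap Q A) := by
        rw [← RingHom.cancel_right (f := (mkI : MvPolynomial ι K →+* Q)) hIsurj]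
        refine MvPolynomial.ringHom_ext (fun a => ?_) fun j => hxx 0 (by omega) j
        have := hK a
        rw [halg] at this
        simpa [← algebraMap_eq] using this
      rw [← RingHom.cancel_right (f := (mkJ : A' →+* A)) hJsurj]
      refine huniq' S _ _ (fun a => ?_) fun t ht j => hxx (t + 1) (by omega) j
      simpa using RingHom.congr_fun hQ a
    · set c : ℂ → ι → ℂ := fun d => Function.update (fun _ => lam) v₀ (lam - d) with hc
      have hc0 : ∀ d ∈ branchScalars (Fintype.card ι) lam n, ∀ j, c d j ≠ 0 := by
        intro d hd' j
        by_cases hj : j = v₀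
        · subst hj; simpa [hc] using hd n (by omega) d hd'
        · simpa [hc, hj] using hlam
      have hcI : ∀ d, edgeIdeal w (c d) (univ.erase v₀) = I := fun d =>
        edgeIdeal_congr fun j hj => by simp [hc, (mem_erase.1 hj).1]
      have hgd : ∀ d, g - algebraMap ℂ Q d * u v₀ ^ Fintype.card ι = mkI (edgeRel w (c d) v₀) := by
        intro d
        rw [hg, hrel, hrel]
        simp only [hc, Function.update_self, map_sub]
        ring
      have hprod : ∀ d, ∏ j, c d j = lam ^ (Fintype.card ι - 1) * (lam - d) := fun d => by
        rw [hc, Finset.prod_update_of_mem (mem_univ v₀), prod_const, mul_comm,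
          Finset.card_sdiff_of_subset (by simp), card_univ, card_singleton]
      refine (hfil'.coker (K := K) (g := g) (q := ∏ i, u i) (e := w ^ Fintype.card ι)
        (T := fun d => edgeScalars (Fintype.card ι) (lam ^ (Fintype.card ι - 1) * (lam - d)))
        ?_ ?_).2 A mkJ.toLinearMap _ hJsurj ?_ ?_
      · intro d hd' z hz
        obtain ⟨p, rfl⟩ := hIsurj z
        rw [hgd, ← map_mul, hIker, ← hcI d] at hz
        rw [hIker, ← hcI d]
        exact mem_edgeIdeal_of_edgeRel_mul (hc0 d hd') hz
      · intro d hd' N _ _ _ _ π ψ hπ hker hψ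
        rw [← hprod]
        refine scalarFiltered_edge (hc0 d hd') (π.restrictScalars K ∘ₗ mkI.toLinearMap) ψ
          (hπ.comp hIsurj) (fun p => ?_) fun p => ?_
        · change π (mkI p) = 0 ↔ _
          rw [hker, hgd, edgeIdeal_insert w (c d) v₀, hcI, Ideal.mem_span_singleton_sup]
          constructor
          · rintro ⟨z, hz⟩
            obtain ⟨q, rfl⟩ := hIsurj z
            refine ⟨q, p - q * edgeRel w (c d) v₀, ?_, by ring⟩
            rw [← hIker, map_sub, map_mul, hz, mul_comm, sub_self]
          · rintro ⟨a, b, hb, rfl⟩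
            exact ⟨mkI a, by rw [map_add, (hIker b).2 hb, map_mul, add_zero, mul_comm]⟩
        · change ψ (π (mkI p)) = π (mkI _)
          rw [hψ, map_mul, map_prod, ← smul_eq_mul, map_smul]
      · intro z
        refine (hJker z).trans (exists_congr fun y => ?_)
        rw [LinearMap.mulLeft_apply, sub_mul, Algebra.smul_def]
      · intro z
        rw [LinearMap.mulLeft_apply, Algebra.smul_def, map_prod]
        rfl

end Branch

section Star

variable {ι : Type} [Fintype ι] [DecidableEq ι]

/-- The scalars by which the sum over all branches of the products of the coordinates of the first
edges acts. -/
noncomputable def starScalars (L : ℕ) (lam : ℂ) : ∀ m : ℕ, (Fin m → ℕ) → Multiset ℂ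
  | 0, _ => {0}
  | m + 1, n => (branchScalars L lam (n 0)).bind fun d =>
      (starScalars L lam m fun i => n i.succ).map fun t => d + t

/-- The universal algebra of a family of branches issued from a vertex of value `1`. -/
theorem exists_starAlgebra (v₀ : ι) {lam : ℂ} (hlam : lam ≠ 0) (m : ℕ) (n : Fin m → ℕ)
    (hd : ∀ i, ∀ s < n i, ∀ d ∈ branchScalars (Fintype.card ι) lam s, lam - d ≠ 0) :
    ∃ (A : Type) (_ : CommRing A) (_ : Algebra ℂ A) (x : Fin m → ℕ → ι → A),
      (∀ i, IsBranch v₀ (algebraMap ℂ A lam) (n i) 1 (x i)) ∧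
      (∀ (S : Type) [CommRing S] (f : ℂ →+* S) (x' : Fin m → ℕ → ι → S),
        (∀ i, IsBranch v₀ (f lam) (n i) 1 (x' i)) →
        ∃ g : A →+* S, (∀ a, g (algebraMap ℂ A a) = f a) ∧
          ∀ i, ∀ t < n i, ∀ j, g (x i t j) = x' i t j) ∧
      (∀ (S : Type) [CommRing S] (g g' : A →+* S),
        (∀ a, g (algebraMap ℂ A a) = g' (algebraMap ℂ A a)) →
        (∀ i, ∀ t < n i, ∀ j, g (x i t j) = g' (x i t j)) → g = g') ∧
      ScalarFiltered (1 : ℂ) A (LinearMap.mulLeft ℂ (∑ i, firstProd (n i) (x i)))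
        (starScalars (Fintype.card ι) lam m n) := by
  induction m with
  | zero =>
    refine ⟨ℂ, inferInstance, inferInstance, fun i => i.elim0, fun i => i.elim0, ?_, ?_, ?_⟩
    · exact fun S _ f x' _ => ⟨f, fun _ => rfl, fun i => i.elim0⟩
    · exact fun S _ g g' h _ => RingHom.ext h
    · exact .scalar 0 (LinearEquiv.refl ℂ ℂ) fun x => by simp
  | succ m ih =>
    obtain ⟨B, _, _, y, hy, hyex, hyuniq, hyfil⟩ := ih (fun i => n i.succ) fun i => hd i.succ
    obtain ⟨A, _, _, x, hx, hxex, hxuniq, hxfil⟩ :=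
      exists_branchAlgebra v₀ hlam (n 0) (hd 0) B 1
    let _ : Algebra ℂ A := ((algebraMap B A).comp (algebraMap ℂ B)).toAlgebra
    have : IsScalarTower ℂ B A := IsScalarTower.of_algebraMap_eq' rfl
    have halg : ∀ a, algebraMap ℂ A a = algebraMap B A (algebraMap ℂ B a) := fun a => rfl
    refine ⟨A, inferInstance, inferInstance,
      Fin.cons x fun i t j => algebraMap B A (y i t j), ?_, ?_, ?_, ?_⟩
    · refine Fin.cases ?_ fun i => ?_
      · rw [map_one] at hx
        exact hx
      · have := (hy i).map (algebraMap B A)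
        rw [map_one] at this
        exact this
    · intro S _ f x' hx'
      obtain ⟨g, hg, hgy⟩ := hyex S f (fun i => x' i.succ) fun i => hx' i.succ
      obtain ⟨h, hh, hhx⟩ := hxex S g (x' 0) (by rw [hg, map_one]; exact hx' 0)
      refine ⟨h, fun a => by rw [halg, hh, hg], Fin.cases hhx fun i t ht j => ?_⟩
      rw [← hgy i t ht j, ← hh]
      rfl
    · intro S _ g g' hg hgx
      refine hxuniq S g g' (fun b => ?_) (hgx 0)
      exact RingHom.congr_fun (hyuniq S (g.comp (algebraMap B A)) (g'.comp (algebraMap B A))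
        hg fun i => hgx i.succ) b
    · rw [one_pow] at hxfil
      refine hyfil.tower hxfil _ fun z => ?_
      rw [Fin.sum_univ_succ, LinearMap.mulLeft_apply, LinearMap.mulLeft_apply, add_mul,
        Algebra.smul_def, map_sum]
      simp only [Fin.cons_zero, Fin.cons_succ, map_firstProd]

end Star

section Scalars

lemma pow_pred_le_pow (L : ℕ) : (L + 1) ^ (L - 1) ≤ L ^ L := by
  classical
  rcases Nat.eq_zero_or_pos L with rfl | hL
  · simp
  · have : Nonempty (Fin L) := ⟨⟨0, hL⟩⟩
    have h := (card_recurrent (ι := Fin L)).symm.le.trans (Finset.card_le_univ _)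
    simpa using h

lemma muPath_succ_zero (n k : ℕ) :
    muPath (n + 1) k 0 = ((k - 1) ^ (k - 1) - k ^ (k - 2)) * (k - 1) ^ (n * (k - 1)) := by
  simp [muPath]

lemma muPath_succ_succ (n k s : ℕ) : muPath (n + 1) k (s + 1) = k ^ (k - 2) * muPath n k s := by
  unfold muPath
  have : n + 1 - (s + 1) - 1 = n - s - 1 := by omega
  simp only [Nat.add_right_cancel_iff, this]
  split_ifs <;> ring

lemma sum_muPath {k : ℕ} (hk : 1 ≤ k) (n : ℕ) :
    ∑ s ∈ range (n + 1), muPath n k s = (k - 1) ^ (n * (k - 1)) := by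
  induction n with
  | zero => simp [muPath]
  | succ n ih =>
    have h := pow_pred_le_pow (k - 1)
    rw [Nat.sub_add_cancel hk, Nat.sub_sub] at h
    rw [sum_range_succ', muPath_succ_zero]
    simp only [muPath_succ_succ]
    rw [← mul_sum, ih, ← add_mul, Nat.add_sub_cancel' h, ← pow_add]
    ring

lemma aseq_succ {k : ℕ} {lam : ℂ} (hlam : lam ≠ 0) (s : ℕ) :
    aseq k lam (s + 1) = lam ^ k / (lam ^ k - aseq k lam s) := by
  cases s with
  | zero => simp [aseq, hlam]
  | succ s => rfl

lemma inv_edge_scalar {k : ℕ} (hk : 2 ≤ k) {lam : ℂ} (hlam : lam ≠ 0) (s : ℕ) :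
    (lam ^ (k - 1 - 1) * (lam - aseq k lam s / lam ^ (k - 1)))⁻¹ =
      aseq k lam (s + 1) / lam ^ (k - 1) := by
  obtain ⟨k, rfl⟩ := Nat.exists_eq_add_of_le' hk
  rw [aseq_succ hlam]
  have h : lam - aseq (k + 2) lam s / lam ^ (k + 2 - 1) =
      (lam ^ (k + 2) - aseq (k + 2) lam s) / lam ^ (k + 1) := by
    rw [show k + 2 - 1 = k + 1 by omega]
    field_simp
    ring
  rw [h]
  simp only [Nat.add_sub_cancel, show k + 2 - 1 = k + 1 by omega]
  rw [mul_inv, inv_div]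
  field_simp
  ring

lemma exists_of_mem_branchScalars {k : ℕ} (hk : 2 ≤ k) {lam : ℂ} (hlam : lam ≠ 0) {n : ℕ} {d : ℂ}
    (hd : d ∈ branchScalars (k - 1) lam n) : ∃ s ≤ n, d = aseq k lam s / lam ^ (k - 1) := by
  induction n generalizing d with
  | zero => exact ⟨0, le_rfl, by simpa [branchScalars, aseq] using hd⟩
  | succ n ih =>
    obtain ⟨b, hb, hdb⟩ := Multiset.mem_bind.1 hd
    obtain ⟨s, hs, rfl⟩ := ih hb
    rw [edgeScalars, Multiset.mem_add] at hdb
    rcases hdb with hdb | hdb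
    · refine ⟨s + 1, by omega, ?_⟩
      rw [Multiset.eq_of_mem_replicate hdb, inv_edge_scalar hk hlam]
    · exact ⟨0, by omega, by rw [Multiset.eq_of_mem_replicate hdb]; simp [aseq]⟩

lemma prod_map_branchScalars {k : ℕ} (hk : 2 ≤ k) {lam : ℂ} (hlam : lam ≠ 0) (n : ℕ) (g : ℂ → ℂ) :
    ((branchScalars (k - 1) lam n).map g).prod =
      ∏ s ∈ range (n + 1), g (aseq k lam s / lam ^ (k - 1)) ^ muPath n k s := by
  induction n generalizing g with
  | zero => simp [branchScalars, muPath, aseq]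
  | succ n ih =>
    rw [branchScalars, Multiset.map_bind, Multiset.prod_bind, ih, prod_range_succ' _ (n + 1),
      muPath_succ_zero, ← sum_muPath (by omega), mul_sum, ← prod_pow_eq_pow_sum,
      ← prod_mul_distrib]
    refine prod_congr rfl fun s _ => ?_
    rw [edgeScalars, inv_edge_scalar hk hlam, Multiset.map_add, Multiset.prod_add,
      Multiset.map_replicate, Multiset.map_replicate, Multiset.prod_replicate,
      Multiset.prod_replicate, mul_pow, ← pow_mul, ← pow_mul, muPath_succ_succ,
      Nat.sub_add_cancel (by omega : 1 ≤ k), Nat.sub_sub]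
    simp [aseq]

lemma prod_map_starScalars {k : ℕ} (hk : 2 ≤ k) {lam : ℂ} (hlam : lam ≠ 0) (m : ℕ) (n : Fin m → ℕ)
    (a : ℂ) :
    ((starScalars (k - 1) lam m n).map fun d => a - d).prod =
      ∏ s : (i : Fin m) → Fin (n i + 1), (a - ∑ i, aseq k lam (s i).val / lam ^ (k - 1)) ^
        (∏ i, muPath (n i) k (s i).val) := by
  induction m generalizing a with
  | zero => simp [starScalars]
  | succ m ih =>
    rw [starScalars, Multiset.map_bind, Multiset.prod_bind]
    simp only [Multiset.map_map, Function.comp_def, ← sub_sub]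
    simp only [ih]
    rw [prod_map_branchScalars hk hlam, prod_range,
      ← (Fin.consEquiv fun i => Fin (n i + 1)).prod_comp, Fintype.prod_prod_type]
    refine prod_congr rfl fun s _ => ?_
    rw [← prod_pow]
    refine prod_congr rfl fun s' _ => ?_
    simp only [Fin.consEquiv_apply, Fin.sum_univ_succ, Fin.prod_univ_succ, Fin.cons_zero,
      Fin.cons_succ]
    rw [← pow_mul, sub_sub, mul_comm]

end Scalars

section StarIdeal

lemma isBranch_iff {ι : Type} [Fintype ι] [DecidableEq ι] {R : Type} [CommRing R] {v₀ : ι}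
    {lam : R} {n : ℕ} {w : R} {x : ℕ → ι → R} :
    IsBranch v₀ lam n w x ↔ ∀ t < n, ∀ j, lam * x t j ^ Fintype.card ι =
      (if t = 0 then w else x (t - 1) v₀) * ∏ i ∈ univ.erase j, x t i +
        if j = v₀ ∧ t + 1 < n then ∏ i, x (t + 1) i else 0 := by
  induction n generalizing w x with
  | zero => simp [IsBranch]
  | succ n ih =>
    rw [IsBranch, ih]
    have h0 : ∀ j, (if j = v₀ then firstProd n (fun t => x (t + 1)) else 0) =
        if j = v₀ ∧ 0 + 1 < n + 1 then ∏ i, x (0 + 1) i else 0 := by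
      intro j
      by_cases hj : j = v₀ <;> by_cases hn : n = 0 <;>
        simp [firstProd, hj, hn, Nat.pos_iff_ne_zero]
    simp only [h0]
    constructor
    · rintro ⟨h₁, h₂⟩ t ht j
      cases t with
      | zero => exact h₁ j
      | succ t =>
        have := h₂ t (by omega) j
        rw [this]
        congr 2
        · cases t <;> rfl
        · simp
    · intro h
      refine ⟨fun j => h 0 (by omega) j, fun t ht j => ?_⟩
      rw [h (t + 1) (by omega) j]
      congr 2
      · cases t <;> rfl
      · simp

lemma inEdge_succ_iff {k s t j : ℕ} (hj : j < k - 1) :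
    inEdge k (s + 1) (j + (k - 1) * t + 1) ↔ s = t ∨ (s = t + 1 ∧ j + 1 = k - 1) := by
  unfold inEdge
  generalize k - 1 = l at *
  rw [Nat.add_sub_cancel, mul_comm l t]
  constructor
  · rintro ⟨h₁, h₂⟩
    have h₃ : t ≤ s := by
      by_contra h
      have := Nat.mul_le_mul_right l (show s + 1 ≤ t by omega)
      omega
    have h₄ : s ≤ t + 1 := by
      by_contra h
      have := Nat.mul_le_mul_right l (show t + 2 ≤ s by omega)
      rw [add_mul] at this
      omega
    rcases (show s = t ∨ s = t + 1 by omega) with rfl | rfl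
    · exact .inl rfl
    · rw [add_mul] at h₁
      exact .inr ⟨rfl, by omega⟩
  · rintro (rfl | ⟨rfl, h⟩)
    all_goals
      simp only [add_mul]
      omega

lemma prod_edge_self {R : Type} [CommRing R] {n l : ℕ} (y : ℕ → Fin l → R) (t : Fin n)
    (j v₀ : Fin l) (hv₀ : v₀.val + 1 = l) :
    ∏ a ∈ univ.filter (fun a : Fin n × Fin l =>
        (t.val = a.1.val ∨ (t.val = a.1.val + 1 ∧ a.2.val + 1 = l)) ∧ a ≠ (t, j)), y a.1 a.2 =
      (if t.val = 0 then 1 else y (t.val - 1) v₀) * ∏ i ∈ univ.erase j, y t i := by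
  split_ifs with ht
  · rw [one_mul, show (univ.filter _ : Finset (Fin n × Fin l)) = {t} ×ˢ univ.erase j from ?_,
      prod_product, prod_singleton]
    ext ⟨a, b⟩
    simp only [mem_filter, mem_univ, true_and, mem_product, mem_singleton, mem_erase, and_true,
      ne_eq, Prod.mk.injEq, Fin.ext_iff]
    omega
  · rw [show (univ.filter _ : Finset (Fin n × Fin l)) =
      insert (⟨t.val - 1, by omega⟩, v₀) ({t} ×ˢ univ.erase j) from ?_, prod_insert,
      prod_product, prod_singleton]
    · simp [Fin.ext_iff]
      omega
    · ext ⟨a, b⟩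
      simp only [mem_filter, mem_univ, true_and, mem_product, mem_singleton, mem_erase, and_true,
        ne_eq, Prod.mk.injEq, Fin.ext_iff, mem_insert]
      omega

lemma prod_edge_next {R : Type} [CommRing R] {n l : ℕ} (y : ℕ → Fin l → R) (t : Fin n)
    (ht : t.val + 1 < n) (j : Fin l) (hj : j.val + 1 = l) :
    ∏ a ∈ univ.filter (fun a : Fin n × Fin l =>
        (t.val + 1 = a.1.val ∨ (t.val + 1 = a.1.val + 1 ∧ a.2.val + 1 = l)) ∧ a ≠ (t, j)),
        y a.1 a.2 =
      ∏ i, y (t.val + 1) i := by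
  rw [show (univ.filter _ : Finset (Fin n × Fin l)) = {⟨t.val + 1, ht⟩} ×ˢ univ from ?_,
    prod_product, prod_singleton]
  ext ⟨a, b⟩
  simp only [mem_filter, mem_univ, true_and, mem_product, mem_singleton, and_true,
    ne_eq, Prod.mk.injEq, Fin.ext_iff]
  omega

variable {k m : ℕ} {n : Fin m → ℕ}

/-- The `j`-th vertex of the `t`-th edge of the `i`-th branch. -/
def starVertex (i : Fin m) (a : Fin (n i) × Fin (k - 1)) : StarIdx k m n := ⟨i, finProdFinEquiv a⟩

lemma starVertex_injective (i : Fin m) : Function.Injective (starVertex (k := k) (n := n) i) :=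
  sigma_mk_injective.comp finProdFinEquiv.injective

lemma exists_starVertex (q : StarIdx k m n) : ∃ a, starVertex q.1 a = q :=
  ⟨finProdFinEquiv.symm q.2, Sigma.ext rfl (heq_of_eq (finProdFinEquiv.apply_symm_apply _))⟩

lemma prod_filter_starVertex {R : Type} [CommRing R] (i : Fin m) (P : StarIdx k m n → Prop)
    [DecidablePred P] (hP : ∀ q, P q → q.1 = i) (y : StarIdx k m n → R) :
    ∏ q ∈ univ.filter P, y q = ∏ a ∈ univ.filter (fun a => P (starVertex i a)),
      y (starVertex i a) := by
  rw [← prod_image (starVertex_injective i).injOn]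
  congr 1
  ext q
  simp only [mem_filter, mem_univ, true_and, mem_image]
  constructor
  · intro h
    obtain rfl := hP q h
    obtain ⟨a, ha⟩ := exists_starVertex q
    exact ⟨a, by rwa [ha], ha⟩
  · rintro ⟨a, ha, rfl⟩
    exact ha

lemma eval₂Hom_fstar {S : Type} [CommRing S] (f : ℂ →+* S) (lam : ℂ) (y : StarIdx k m n → S)
    (x : ℕ → Fin (k - 1) → S) (i : Fin m)
    (hy : ∀ a : Fin (n i) × Fin (k - 1), y (starVertex i a) = x a.1 a.2)
    (v₀ : Fin (k - 1)) (hv₀ : v₀.val + 1 = k - 1) (t : Fin (n i)) (j : Fin (k - 1)) :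
    eval₂Hom f y (fstar k n lam (starVertex i (t, j))) = f lam * x t j ^ (k - 1) -
      ((if t.val = 0 then 1 else x (t.val - 1) v₀) * ∏ i ∈ univ.erase j, x t i +
        if j = v₀ ∧ t.val + 1 < n i then ∏ i, x (t.val + 1) i else 0) := by
  have hE : ∀ s, ∏ q ∈ (univ.filter fun q : StarIdx k m n =>
      q.1 = i ∧ inEdge k (s + 1) (q.2.val + 1)).erase (starVertex i (t, j)), y q =
      ∏ a ∈ univ.filter (fun a : Fin (n i) × Fin (k - 1) =>
        (s = a.1.val ∨ (s = a.1.val + 1 ∧ a.2.val + 1 = k - 1)) ∧ a ≠ (t, j)), x a.1 a.2 := by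
    intro s
    rw [← filter_ne', filter_filter, prod_filter_starVertex i _ fun q h => h.1.1]
    refine prod_congr (filter_congr fun a _ => ?_) fun a _ => hy a
    rw [(starVertex_injective i).ne_iff]
    simp only [starVertex, true_and, finProdFinEquiv_apply_val, inEdge_succ_iff a.2.2]
  have hv : j = v₀ ↔ j.val + 1 = k - 1 := by rw [Fin.ext_iff]; omega
  have hT : (Icc 1 (n i)).filter (fun s => inEdge k s ((finProdFinEquiv (t, j)).val + 1)) =
      if j = v₀ ∧ t.val + 1 < n i then {t.val + 1, t.val + 2} else {t.val + 1} := by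
    have hif : ∀ s, (s ∈ if j = v₀ ∧ t.val + 1 < n i then ({t.val + 1, t.val + 2} : Finset ℕ)
        else {t.val + 1}) ↔ s = t.val + 1 ∨ ((j = v₀ ∧ t.val + 1 < n i) ∧ s = t.val + 2) := by
      intro s
      split_ifs with h <;> simp [h]
    ext s
    rw [hif, hv, mem_filter, mem_Icc, finProdFinEquiv_apply_val]
    cases s with
    | zero => omega
    | succ s =>
      rw [inEdge_succ_iff j.2]
      dsimp only
      have := t.2
      omega
  rw [fstar, map_sub, map_mul, map_pow, map_sum]
  simp only [map_prod, eval₂Hom_C, coe_eval₂Hom, eval₂_X, hy]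
  congr 1
  change ∑ s ∈ (Icc 1 (n i)).filter (fun s => inEdge k s ((finProdFinEquiv (t, j)).val + 1)),
    ∏ q ∈ (univ.filter fun q : StarIdx k m n =>
      q.1 = i ∧ inEdge k s (q.2.val + 1)).erase (starVertex i (t, j)), y q = _
  rw [hT, ← prod_edge_self x t j v₀ hv₀, ← hE]
  split_ifs with h
  · rw [sum_pair (by omega), hE (t.val + 1), prod_edge_next x t h.2 j (hv.1 h.1)]
  · rw [sum_singleton, add_zero]

lemma isBranch_iff_fstar {S : Type} [CommRing S] (f : ℂ →+* S) (lam : ℂ) (y : StarIdx k m n → S)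
    (x : Fin m → ℕ → Fin (k - 1) → S)
    (hy : ∀ i, ∀ a : Fin (n i) × Fin (k - 1), y (starVertex i a) = x i a.1 a.2)
    (v₀ : Fin (k - 1)) (hv₀ : v₀.val + 1 = k - 1) :
    (∀ i, IsBranch v₀ (f lam) (n i) 1 (x i)) ↔ ∀ q, eval₂Hom f y (fstar k n lam q) = 0 := by
  simp only [isBranch_iff, Fintype.card_fin]
  constructor
  · intro h q
    obtain ⟨a, ha⟩ := exists_starVertex q
    rw [← ha, eval₂Hom_fstar f lam y _ _ (hy q.1) v₀ hv₀, sub_eq_zero]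
    exact h q.1 a.1 a.1.2 a.2
  · intro h i t ht j
    have := h (starVertex i (⟨t, ht⟩, j))
    rwa [eval₂Hom_fstar f lam y _ _ (hy i) v₀ hv₀, sub_eq_zero] at this

lemma prod_firstEdge {S : Type} [CommRing S] (y : StarIdx k m n → S)
    (x : ℕ → Fin (k - 1) → S) (i : Fin m) (hi : 1 ≤ n i)
    (hy : ∀ a : Fin (n i) × Fin (k - 1), y (starVertex i a) = x a.1 a.2) :
    ∏ q ∈ univ.filter (fun q : StarIdx k m n => q.1 = i ∧ q.2.val + 1 ≤ k - 1), y q =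
      firstProd (n i) x := by
  rw [prod_filter_starVertex i _ fun q h => h.1, firstProd, if_neg (by omega),
    show (univ.filter _ : Finset (Fin (n i) × Fin (k - 1))) = {⟨0, hi⟩} ×ˢ univ from ?_,
    prod_product, prod_singleton]
  · exact prod_congr rfl fun j _ => hy _
  · ext ⟨a, b⟩
    simp only [mem_filter, mem_univ, true_and, mem_product, mem_singleton, and_true,
      starVertex, finProdFinEquiv_apply_val, Fin.ext_iff]
    constructor
    · intro h
      by_contra h0
      have := Nat.mul_le_mul_left (k - 1) (Nat.pos_of_ne_zero h0)
      omega
    · intro h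
      rw [h]
      omega

end StarIdeal

/-- For the starlike hypergraph `S^k_{n_1,…,n_m}`, `λ ≠ 0` with
`λ^k - a_{i-1} ≠ 0` for all `0 ≤ i ≤ max_j n_j`, and `A` finite dimensional:
the determinant of multiplication by `λ - ∑_{i=1}^m ∏_{v=1}^{k-1} x_{i,v}` on
`A` equals `∏_{(s_1,…,s_m), 0 ≤ s_i ≤ n_i}
(λ - ∑_i a_{s_i-1}/λ^{k-1})^{∏_i μ_{n_i,k}(s_i)}`. -/
theorem starlike_multiplication_det (k m : ℕ) (hk : 3 ≤ k) (hm : 1 ≤ m)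
    (n : Fin m → ℕ) (hn : ∀ i, 1 ≤ n i) (lam : ℂ) (hlam : lam ≠ 0)
    (hden : ∀ i ≤ Finset.univ.sup n, lam ^ k - aseq k lam i ≠ 0)
    (hfin : FiniteDimensional ℂ
      (MvPolynomial (StarIdx k m n) ℂ ⧸ starIdeal k n lam)) :
    LinearMap.det (LinearMap.mulLeft ℂ
        (Ideal.Quotient.mk (starIdeal k n lam)
          (C lam - ∑ i : Fin m,
            ∏ q ∈ Finset.univ.filter
              (fun q : StarIdx k m n => q.1 = i ∧ q.2.val + 1 ≤ k - 1), X q))) =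
      ∏ s : (i : Fin m) → Fin (n i + 1),
        (lam - ∑ i, aseq k lam (s i).val / lam ^ (k - 1)) ^
          (∏ i, muPath (n i) k (s i).val) := by
  have hk2 : 2 ≤ k := by omega
  set mkI := Ideal.Quotient.mk (starIdeal k n lam) with hmkI
  let v₀ : Fin (k - 1) := ⟨k - 2, by omega⟩
  have hv₀ : v₀.val + 1 = k - 1 := by simp only [v₀]; omega
  have hd : ∀ i, ∀ s < n i, ∀ d ∈ branchScalars (Fintype.card (Fin (k - 1))) lam s,
      lam - d ≠ 0 := by
    intro i s hs d hd
    rw [Fintype.card_fin] at hd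
    obtain ⟨r, hr, rfl⟩ := exists_of_mem_branchScalars hk2 hlam hd
    have h1 := hden r ((hr.trans hs.le).trans (Finset.le_sup (f := n) (mem_univ i)))
    intro h2
    apply h1
    rw [sub_eq_zero, eq_div_iff (pow_ne_zero _ hlam), ← pow_succ', Nat.sub_add_cancel (by omega)]
      at h2
    rw [h2, sub_self]
  obtain ⟨A, _, _, x, hx, hxex, hxuniq, hxfil⟩ := exists_starAlgebra v₀ hlam m n hd
  rw [Fintype.card_fin] at hxfil
  let x' : Fin m → ℕ → Fin (k - 1) → MvPolynomial (StarIdx k m n) ℂ ⧸ starIdeal k n lam :=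
    fun i t j => if h : t < n i then mkI (X (starVertex i (⟨t, h⟩, j))) else 0
  have hx' : ∀ i, ∀ a : Fin (n i) × Fin (k - 1), mkI (X (starVertex i a)) = x' i a.1 a.2 := by
    intro i a
    simp [x']
  have hmk : eval₂Hom (mkI.comp C) (fun q => mkI (X q)) = mkI :=
    MvPolynomial.ringHom_ext (fun a => by simp) fun q => by simp
  obtain ⟨F, hF, hFx⟩ := hxex _ (mkI.comp C) x' (by
    rw [isBranch_iff_fstar _ _ (fun q => mkI (X q)) x' hx' v₀ hv₀, hmk]
    exact fun q => Ideal.Quotient.eq_zero_iff_mem.2 (Ideal.subset_span ⟨q, rfl⟩))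
  let y : StarIdx k m n → A := fun q =>
    x q.1 (finProdFinEquiv.symm q.2).1 (finProdFinEquiv.symm q.2).2
  have hy : ∀ i, ∀ a : Fin (n i) × Fin (k - 1), y (starVertex i a) = x i a.1 a.2 := by
    intro i a
    simp only [y, starVertex, Equiv.symm_apply_apply]
  let G : (MvPolynomial (StarIdx k m n) ℂ ⧸ starIdeal k n lam) →+* A :=
    Ideal.Quotient.lift _ (eval₂Hom (algebraMap ℂ A) y) (by
      change starIdeal k n lam ≤ RingHom.ker _
      refine Ideal.span_le.2 ?_
      rintro _ ⟨q, rfl⟩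
      exact (isBranch_iff_fstar (algebraMap ℂ A) lam y x hy v₀ hv₀).1 hx q)
  have hG : ∀ p, G (mkI p) = eval₂Hom (algebraMap ℂ A) y p := fun p => rfl
  have hGF : G.comp F = RingHom.id A := by
    refine hxuniq A _ _ (fun a => ?_) fun i t ht j => ?_
    · simp [hF, hG]
    · have := hx' i (⟨t, ht⟩, j)
      simp only at this
      simp [hFx i t ht j, ← this, hG, hy]
  have hFG : F.comp G = RingHom.id _ := by
    refine Ideal.Quotient.ringHom_ext (MvPolynomial.ringHom_ext (fun a => ?_) fun q => ?_)
    · change F (G (mkI (C a))) = mkI (C a)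
      simp [hF, hG]
    · change F (G (mkI (X q))) = mkI (X q)
      obtain ⟨a, ha⟩ := exists_starVertex q
      rw [hG, coe_eval₂Hom, eval₂_X, ← ha, hy, hFx _ _ a.1.2, hx']
  let E : (MvPolynomial (StarIdx k m n) ℂ ⧸ starIdeal k n lam) ≃ₗ[ℂ] A :=
    (AlgEquiv.ofRingEquiv (f := RingEquiv.ofRingHom G F hGF hFG) (fun a => by
      change G (mkI (C a)) = _
      simp [hG])).toLinearEquiv
  have hEG : ∀ z, E z = G z := fun z => rfl
  have hfirst : G (mkI (∑ i : Fin m, ∏ q ∈ univ.filter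
      (fun q : StarIdx k m n => q.1 = i ∧ q.2.val + 1 ≤ k - 1), X q)) =
      ∑ i, firstProd (n i) (x i) := by
    rw [hG, map_sum]
    refine sum_congr rfl fun i _ => ?_
    rw [map_prod, ← prod_firstEdge y (x i) i (hn i) (hy i)]
    simp
  have hfil := ScalarFiltered.of_equiv (ψ := LinearMap.mulLeft ℂ (mkI (∑ i : Fin m,
    ∏ q ∈ univ.filter (fun q : StarIdx k m n => q.1 = i ∧ q.2.val + 1 ≤ k - 1), X q))) E
    (fun z => by
      rw [LinearMap.mulLeft_apply, LinearMap.mulLeft_apply, hEG, hEG, map_mul, hfirst]) hxfil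
  rw [← prod_map_starScalars hk2 hlam, ← hfil.det_sub]
  congr 1
  refine LinearMap.ext fun z => ?_
  rw [LinearMap.mulLeft_apply, map_sub, sub_mul, LinearMap.sub_apply, LinearMap.mulLeft_apply,
    Module.algebraMap_end_apply]
  exact congrArg₂ _ (Algebra.smul_def lam z).symm rfl
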